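/- arXiv:1511.07044 — 2 statements merged into one kernel-verified Lean document; each statement's English description precedes it below -/
import Mathlib

section
/- Let n ≥ 1, let 1 ≤ m ≤ n, and let I ⊆ ℝ[x₀,…,x_n] be a homogeneous ideal defining an irreducible nondegenerate projective variety of dimension m that has a smooth real point. Then for every nonzero p ∈ ℝ^{n+1}, the real rank of p with respect to V_ℝ(I) satisfies rank_{V_ℝ(I)}(p) ≤ n − m + 2. -/
open scoped BigOperators
open MvPolynomial

/-- The real rank of `p` with respect to a subset `S` of a real vector space:
the least `r : ℕ∞` such that `p` is a sum of `r` elements of `S` (`∞` if none exists). -/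
noncomputable def realRank {V : Type*} [AddCommMonoid V] (S : Set V) (p : V) : ℕ∞ :=
  sInf ((fun n : ℕ => (n : ℕ∞)) ''
    {r : ℕ | ∃ x : Fin r → V, (∀ i, x i ∈ S) ∧ ∑ i, x i = p})

/-- The real zero set `V_ℝ(I) ⊆ ℝ^{n+1}` of an ideal `I ⊆ ℝ[x₀,…,x_n]`. -/
def realVariety {n : ℕ} (I : Ideal (MvPolynomial (Fin (n + 1)) ℝ)) : Set (Fin (n + 1) → ℝ) :=
  {x | ∀ f ∈ I, eval x f = 0}

lemma MvPolynomial.height_eq_of_isMaximal {k : Type*} [Field k] (s : ℕ)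
    (M : Ideal (MvPolynomial (Fin s) k)) [hM : M.IsMaximal] : M.height = s := by
  induction s with
  | zero =>
    have : M.height ≤ 0 := by
      have h := Ideal.height_le_ringKrullDim_of_ne_top hM.ne_top
      rw [MvPolynomial.ringKrullDim_of_isNoetherianRing] at h
      simpa using h
    simpa using this
  | succ s ih =>
    let e := (finSuccEquiv k s).toRingEquiv
    let P : Ideal (Polynomial (MvPolynomial (Fin s) k)) := M.comap (e.symm : _ →+* _)
    have hP : P.IsMaximal := Ideal.comap_isMaximal_of_surjective _ e.symm.surjective
    have hPM : P.height = M.height := RingEquiv.height_comap e.symm M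
    let p := P.comap (Polynomial.C : MvPolynomial (Fin s) k →+* _)
    have hp : p.IsMaximal := Polynomial.isMaximal_comap_C_of_isJacobsonRing P
    have : P.LiesOver p := ⟨rfl⟩
    rw [← hPM, Polynomial.height_eq_height_add_one p P, ih p]
    simp

lemma ringKrullDim_le_of_isIntegral {A B : Type*} [CommRing A] [CommRing B] [Algebra A B]
    [Algebra.IsIntegral A B] : ringKrullDim B ≤ ringKrullDim A := by
  refine Order.krullDim_le_of_strictMono (PrimeSpectrum.comap (algebraMap A B)) fun P Q h ↦ ?_
  obtain ⟨x, hxQ, hxP⟩ := SetLike.exists_of_lt (show P.asIdeal < Q.asIdeal from h)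
  exact Ideal.comap_lt_comap_of_integral_mem_sdiff (le_of_lt h) ⟨hxQ, hxP⟩
    (Algebra.IsIntegral.isIntegral x)

/-- All maximal ideals of an affine domain have height the dimension of the domain. -/
lemma ringKrullDim_le_height_of_isMaximal (k : Type*) {A : Type*} [Field k] [CommRing A]
    [IsDomain A] [Algebra k A] [Algebra.FiniteType k A] (M : Ideal A) [hM : M.IsMaximal] :
    ringKrullDim A ≤ M.height := by
  obtain ⟨s, g, hinj, hint⟩ := exists_integral_inj_algHom_of_fg k A
  algebraize [g.toRingHom]
  have : FaithfulSMul (MvPolynomial (Fin s) k) A :=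
    (faithfulSMul_iff_algebraMap_injective _ _).2 hinj
  have : IsNoetherianRing A := Algebra.FiniteType.isNoetherianRing k A
  have hmax : (M.under (MvPolynomial (Fin s) k)).IsMaximal :=
    Ideal.isMaximal_comap_of_isIntegral_of_isMaximal M
  refine (ringKrullDim_le_of_isIntegral (A := MvPolynomial (Fin s) k)).trans ?_
  rw [Ideal.height_eq_height_add_of_liesOver_of_hasGoingDown
    (M.under (MvPolynomial (Fin s) k)) M, MvPolynomial.height_eq_of_isMaximal s,
    MvPolynomial.ringKrullDim_of_isNoetherianRing]
  simp only [ringKrullDim_eq_zero_of_field, Nat.card_eq_fintype_card, Fintype.card_fin, zero_add]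
  exact_mod_cast le_self_add

/-- The elements multiplied into `F` by an element outside the prime ideal `𝔪`. -/
def Ideal.saturationAt {R : Type*} [CommRing R] (F 𝔪 : Ideal R) [h𝔪 : 𝔪.IsPrime] : Ideal R where
  carrier := {g | ∃ h ∉ 𝔪, h * g ∈ F}
  add_mem' := by
    rintro a b ⟨h, hh, ha⟩ ⟨k, hk, hb⟩
    refine ⟨h * k, fun H => (h𝔪.mem_or_mem H).elim hh hk, ?_⟩
    convert add_mem (F.mul_mem_left k ha) (F.mul_mem_left h hb) using 1
    ring
  zero_mem' := ⟨1, h𝔪.one_notMem, by simp⟩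
  smul_mem' := by
    rintro a b ⟨h, hh, hb⟩
    refine ⟨h, hh, ?_⟩
    convert F.mul_mem_left a hb using 1
    simp only [smul_eq_mul]
    ring

lemma Ideal.le_saturationAt {R : Type*} [CommRing R] (F 𝔪 : Ideal R) [h𝔪 : 𝔪.IsPrime] :
    F ≤ F.saturationAt 𝔪 := fun _ hg => ⟨1, h𝔪.one_notMem, by simpa using hg⟩

lemma Ideal.saturationAt_le_of_isPrime {R : Type*} [CommRing R] {F I 𝔪 : Ideal R} [𝔪.IsPrime]
    [hI : I.IsPrime] (hFI : F ≤ I) (hI𝔪 : I ≤ 𝔪) : F.saturationAt 𝔪 ≤ I := by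
  rintro g ⟨u, hu, hug⟩
  exact (hI.mem_or_mem (hFI hug)).resolve_left fun H => hu (hI𝔪 H)

lemma Ideal.mul_mem_sup_pow_add {R : Type*} [CommRing R] {F 𝔪 : Ideal R} {i j : ℕ} {a b : R}
    (ha : a ∈ F ⊔ 𝔪 ^ i) (hb : b ∈ F ⊔ 𝔪 ^ j) : a * b ∈ F ⊔ 𝔪 ^ (i + j) := by
  suffices h : (F ⊔ 𝔪 ^ i) * (F ⊔ 𝔪 ^ j) ≤ F ⊔ 𝔪 ^ (i + j) from h (Ideal.mul_mem_mul ha hb)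
  rw [Ideal.sup_mul, Ideal.mul_sup (𝔪 ^ i), ← pow_add]
  exact sup_le (le_sup_of_le_left Ideal.mul_le_left)
    (sup_le (le_sup_of_le_left Ideal.mul_le_right) le_sup_right)

/-- A form of the Krull intersection theorem. -/
lemma Ideal.mem_saturationAt_of_forall_mem_sup_pow {R : Type*} [CommRing R] [IsNoetherianRing R]
    {F 𝔪 : Ideal R} [h𝔪 : 𝔪.IsPrime] {g : R} (hg : ∀ k, g ∈ F ⊔ 𝔪 ^ k) :
    g ∈ F.saturationAt 𝔪 := by
  have hmem : Ideal.Quotient.mk F g ∈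
      (⨅ i : ℕ, (𝔪.map (Ideal.Quotient.mk F)) ^ i • ⊤ : Submodule (R ⧸ F) (R ⧸ F)) := by
    rw [Submodule.mem_iInf]
    intro i
    have h := Ideal.mem_map_of_mem (Ideal.Quotient.mk F) (hg i)
    rw [Ideal.map_sup, Ideal.map_quotient_self, bot_sup_eq, Ideal.map_pow] at h
    simpa using h
  obtain ⟨⟨r, hr⟩, hrg⟩ := (Ideal.mem_iInf_smul_pow_eq_bot_iff _ _).1 hmem
  obtain ⟨s, hs, rfl⟩ :=
    (Ideal.mem_map_iff_of_surjective _ Ideal.Quotient.mk_surjective).1 hr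
  refine ⟨1 - s, fun h => h𝔪.one_notMem ?_, ?_⟩
  · simpa using add_mem h hs
  · rw [← Ideal.Quotient.eq_zero_iff_mem]
    change Ideal.Quotient.mk F s * Ideal.Quotient.mk F g = _ at hrg
    simp [sub_mul, hrg]

namespace MvPolynomial

open Filter Topology Asymptotics

section Gradient

variable {σ : Type*} {x : σ → ℝ}

/-- The gradient of a polynomial at a point. -/
noncomputable def gradientAt (x : σ → ℝ) (f : MvPolynomial σ ℝ) : σ → ℝ :=
  fun i => eval x (pderiv i f)

lemma gradientAt_sub (f g : MvPolynomial σ ℝ) :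
    gradientAt x (f - g) = gradientAt x f - gradientAt x g := by
  ext i; simp [gradientAt]

lemma gradientAt_sum_C_mul {ι : Type*} [Fintype ι] (c : ι → ℝ) (f : ι → MvPolynomial σ ℝ) :
    gradientAt x (∑ k, C (c k) * f k) = ∑ k, c k • gradientAt x (f k) := by
  ext i; simp [gradientAt, Finset.sum_apply]

lemma ker_eval_eq_span (x : σ → ℝ) :
    RingHom.ker (eval x) = Ideal.span (Set.range fun i => X i - C (x i)) := by
  refine le_antisymm (fun f hf => ?_) ?_
  · have key : ∀ g : MvPolynomial σ ℝ,
        g - C (eval x g) ∈ Ideal.span (Set.range fun i => X i - C (x i)) := by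
      intro g
      induction g using MvPolynomial.induction_on with
      | C a => simp
      | add p q hp hq => convert add_mem hp hq using 1; simp; ring
      | mul_X p j hp =>
        have hj : (X j - C (x j) : MvPolynomial σ ℝ) ∈
            Ideal.span (Set.range fun i => X i - C (x i)) := Ideal.subset_span ⟨j, rfl⟩
        convert add_mem (Ideal.mul_mem_left _ p hj) (Ideal.mul_mem_right (C (x j)) _ hp) using 1
        simp; ring
    simpa [(RingHom.mem_ker).1 hf] using key f
  · rw [Ideal.span_le]
    rintro _ ⟨i, rfl⟩
    simp [RingHom.mem_ker]

variable [Fintype σ]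

lemma hasStrictFDerivAt_eval (x : σ → ℝ) (f : MvPolynomial σ ℝ) :
    HasStrictFDerivAt (fun z => eval z f)
      (∑ i, gradientAt x f i • ContinuousLinearMap.proj (R := ℝ) (φ := fun _ : σ => ℝ) i) x := by
  classical
  induction f using MvPolynomial.induction_on with
  | C a => simpa [gradientAt] using hasStrictFDerivAt_const (𝕜 := ℝ) a x
  | add p q hp hq =>
    simp only [map_add]
    refine (hp.fun_add hq).congr_fderiv ?_
    simp [gradientAt, add_smul, Finset.sum_add_distrib]
  | mul_X p j hp =>
    have hj : HasStrictFDerivAt (fun z : σ → ℝ => z j)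
        (ContinuousLinearMap.proj (R := ℝ) (φ := fun _ : σ => ℝ) j) x :=
      (ContinuousLinearMap.proj (R := ℝ) (φ := fun _ : σ => ℝ) j).hasStrictFDerivAt
    simp only [map_mul, eval_X]
    refine (hp.fun_mul hj).congr_fderiv ?_
    ext v
    simp [gradientAt, pderiv_X, add_mul, Finset.sum_add_distrib, Pi.single_apply,
      Finset.mul_sum, apply_ite (eval x), mul_assoc]

lemma mem_sq_ker_eval {f : MvPolynomial σ ℝ} (hf : f ∈ RingHom.ker (eval x))
    (hgrad : gradientAt x f = 0) : f ∈ RingHom.ker (eval x) ^ 2 := by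
  classical
  rw [ker_eval_eq_span, Ideal.mem_span_range_iff_exists_fun] at hf
  obtain ⟨b, rfl⟩ := hf
  have hb : ∀ i, b i ∈ RingHom.ker (eval x) := by
    intro i
    have := congrFun hgrad i
    simpa [gradientAt, pderiv_X, Pi.single_apply, RingHom.mem_ker,
      apply_ite (eval x)] using this
  rw [pow_two]
  refine Ideal.sum_mem _ fun i _ => Ideal.mul_mem_mul (hb i) ?_
  simp [RingHom.mem_ker]

lemma isBigO_of_mem_ker_eval_pow {k : ℕ} {f : MvPolynomial σ ℝ}
    (hf : f ∈ RingHom.ker (eval x) ^ k) :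
    (fun z => eval z f) =O[𝓝 x] fun z => ‖z - x‖ ^ k := by
  induction k generalizing f with
  | zero =>
    simpa using ((hasStrictFDerivAt_eval x f).hasFDerivAt.continuousAt.tendsto.isBigO_one ℝ)
  | succ k ih =>
    rw [pow_succ] at hf
    refine Submodule.mul_induction_on hf (fun a ha b hb => ?_) fun a b ha hb => ?_
    · have h1 := (hasStrictFDerivAt_eval x b).hasFDerivAt.isBigO_sub
      rw [RingHom.mem_ker] at hb
      simp only [hb, sub_zero] at h1
      simpa [pow_succ] using (ih ha).mul h1.norm_right
    · simpa using ha.add hb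

end Gradient

section Homogeneous

lemma IsHomogeneous.aeval_mem_pow {κ R A : Type*} [CommRing R] [CommRing A] [Algebra R A]
    {P : MvPolynomial κ R} {k : ℕ} (hP : P.IsHomogeneous k) {I : Ideal A} {y : κ → A}
    (hy : ∀ j, y j ∈ I) : MvPolynomial.aeval y P ∈ I ^ k := by
  rw [aeval_def, eval₂_eq]
  refine Ideal.sum_mem _ fun d hd => Ideal.mul_mem_left _ _ ?_
  have hk : ∑ i ∈ d.support, d i = k := by
    simpa [Finsupp.weight_apply, Finsupp.sum] using hP (mem_support_iff.1 hd)
  rw [← hk, ← Finset.prod_pow_eq_pow_sum]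
  exact Ideal.prod_mem_prod fun i _ => Ideal.pow_mem_pow (hy i) _

lemma IsHomogeneous.eval_smul {κ R : Type*} [CommRing R] {P : MvPolynomial κ R} {k : ℕ}
    (hP : P.IsHomogeneous k) (t : R) (w : κ → R) : eval (t • w) P = t ^ k * eval w P := by
  rw [eval_eq, eval_eq, Finset.mul_sum]
  refine Finset.sum_congr rfl fun d hd => ?_
  have hk : ∑ i ∈ d.support, d i = k := by
    simpa [Finsupp.weight_apply, Finsupp.sum] using hP (mem_support_iff.1 hd)
  simp only [Pi.smul_apply, smul_eq_mul, mul_pow, Finset.prod_mul_distrib,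
    Finset.prod_pow_eq_pow_sum, hk]
  ring

end Homogeneous

variable {σ ι κ : Type*}

instance isMaximal_ker_eval (x : σ → ℝ) : (RingHom.ker (eval x)).IsMaximal :=
  RingHom.ker_isMaximal_of_surjective _ fun a => ⟨C a, by simp⟩

/-- Polynomials `f`, `y` which together form a system of local coordinates at `x`. -/
structure IsCoordinateSystemAt (x : σ → ℝ) (f : ι → MvPolynomial σ ℝ)
    (y : κ → MvPolynomial σ ℝ) : Prop where
  eval_left : ∀ i, eval x (f i) = 0
  eval_right : ∀ j, eval x (y j) = 0
  linearIndependent : LinearIndependent ℝ fun s => gradientAt x (Sum.elim f y s)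
  span_eq_top : Submodule.span ℝ (Set.range fun s => gradientAt x (Sum.elim f y s)) = ⊤

namespace IsCoordinateSystemAt

variable {x : σ → ℝ} {f : ι → MvPolynomial σ ℝ} {y : κ → MvPolynomial σ ℝ}

local notation "𝔪" => RingHom.ker (eval x)
local notation "F" => Ideal.span (Set.range f)

lemma aeval_mem_pow (h : IsCoordinateSystemAt x f y) {k : ℕ} {P : MvPolynomial κ ℝ}
    (hP : P.IsHomogeneous k) : aeval y P ∈ 𝔪 ^ k :=
  hP.aeval_mem_pow fun j => (RingHom.mem_ker).2 (h.eval_right j)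

lemma mul_sub_aeval_mem (h : IsCoordinateSystemAt x f y) {i j : ℕ} {a b : MvPolynomial σ ℝ}
    {P Q : MvPolynomial κ ℝ} (hP : P.IsHomogeneous i) (hQ : Q.IsHomogeneous j)
    (ha : a - aeval y P ∈ F ⊔ 𝔪 ^ (i + 1)) (hb : b - aeval y Q ∈ F ⊔ 𝔪 ^ (j + 1)) :
    a * b - aeval y (P * Q) ∈ F ⊔ 𝔪 ^ (i + j + 1) := by
  have hP' : aeval y P ∈ F ⊔ 𝔪 ^ i := Ideal.mem_sup_right (h.aeval_mem_pow hP)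
  have hQ' : aeval y Q ∈ F ⊔ 𝔪 ^ j := Ideal.mem_sup_right (h.aeval_mem_pow hQ)
  have h1 : (a - aeval y P) * (b - aeval y Q) ∈ F ⊔ 𝔪 ^ (i + j + 1) :=
    (sup_le_sup_left (Ideal.pow_le_pow_right (by omega)) _ :
      F ⊔ 𝔪 ^ (i + 1 + (j + 1)) ≤ F ⊔ 𝔪 ^ (i + j + 1)) (Ideal.mul_mem_sup_pow_add ha hb)
  have h2 := Ideal.mul_mem_sup_pow_add hP' hb
  have h3 := Ideal.mul_mem_sup_pow_add ha hQ'
  rw [show i + 1 + j = i + j + 1 by omega] at h3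
  convert add_mem (add_mem h1 h2) h3 using 1
  rw [map_mul]
  ring

variable [Fintype σ]

lemma eventually_eval_eq_zero {g : MvPolynomial σ ℝ} (hg : g ∈ (F).saturationAt 𝔪) :
    ∀ᶠ z in 𝓝 x, (∀ i, eval z (f i) = 0) → eval z g = 0 := by
  obtain ⟨h, hh, hhg⟩ := hg
  have hc : ContinuousAt (fun z => eval z h) x := (hasStrictFDerivAt_eval x h).continuousAt
  filter_upwards [hc.eventually_ne hh] with z hz hfz
  have hle : F ≤ RingHom.ker (eval z) := by
    rw [Ideal.span_le]
    rintro _ ⟨i, rfl⟩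
    exact hfz i
  have := hle hhg
  rw [RingHom.mem_ker, map_mul] at this
  exact (mul_eq_zero.1 this).resolve_left hz

variable [Fintype ι] [Fintype κ]

lemma exists_linear (h : IsCoordinateSystemAt x f y) {a : MvPolynomial σ ℝ} (ha : a ∈ 𝔪) :
    ∃ P : MvPolynomial κ ℝ, P.IsHomogeneous 1 ∧ a - aeval y P ∈ F ⊔ 𝔪 ^ 2 := by
  have hs : gradientAt x a ∈ Submodule.span ℝ
      (Set.range fun s => gradientAt x (Sum.elim f y s)) := by rw [h.span_eq_top]; trivial
  obtain ⟨c, hc⟩ := (Submodule.mem_span_range_iff_exists_fun ℝ).1 hs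
  refine ⟨∑ j, C (c (.inr j)) * X j, ?_, ?_⟩
  · exact IsHomogeneous.sum _ _ _ fun j _ => by
      simpa using (isHomogeneous_C κ (c (.inr j))).mul (isHomogeneous_X ℝ j)
  · have key : a - ∑ s, C (c s) * Sum.elim f y s ∈ 𝔪 ^ 2 := by
      refine mem_sq_ker_eval ?_ ?_
      · simp [RingHom.mem_ker, (RingHom.mem_ker).1 ha, h.eval_left, h.eval_right]
      · rw [gradientAt_sub, gradientAt_sum_C_mul, hc, sub_self]
    have hF : ∑ i, C (c (.inl i)) * f i ∈ F :=
      Ideal.sum_mem _ fun i _ => Ideal.mul_mem_left _ _ (Ideal.subset_span ⟨i, rfl⟩)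
    convert add_mem (Ideal.mem_sup_right key) (Ideal.mem_sup_left hF) using 1
    simp only [Fintype.sum_sum_type, Sum.elim_inl, Sum.elim_inr, map_sum, map_mul, aeval_X,
      aeval_C, algebraMap_eq]
    ring

lemma exists_isHomogeneous (h : IsCoordinateSystemAt x f y) {k : ℕ} {g : MvPolynomial σ ℝ}
    (hg : g ∈ 𝔪 ^ k) :
    ∃ P : MvPolynomial κ ℝ, P.IsHomogeneous k ∧ g - aeval y P ∈ F ⊔ 𝔪 ^ (k + 1) := by
  induction k generalizing g with
  | zero =>
    refine ⟨C (eval x g), isHomogeneous_C _ _, Ideal.mem_sup_right ?_⟩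
    simp [RingHom.mem_ker, algebraMap_eq]
  | succ k ih =>
    rw [pow_succ] at hg
    refine Submodule.mul_induction_on hg (fun a ha b hb => ?_) fun a b ha hb => ?_
    · obtain ⟨P, hP, hPa⟩ := ih ha
      obtain ⟨Q, hQ, hQb⟩ := h.exists_linear hb
      exact ⟨P * Q, hP.mul hQ, h.mul_sub_aeval_mem hP hQ hPa hQb⟩
    · obtain ⟨P, hP, hPa⟩ := ha
      obtain ⟨Q, hQ, hQb⟩ := hb
      refine ⟨P + Q, hP.add hQ, ?_⟩
      convert add_mem hPa hQb using 1
      rw [map_add]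
      ring

/-- A polynomial not vanishing in the local ring modulo `f` has a nonzero leading form. -/
lemma exists_leading_form (h : IsCoordinateSystemAt x f y) {g : MvPolynomial σ ℝ}
    (hg : g ∉ (F).saturationAt 𝔪) :
    ∃ k, ∃ P : MvPolynomial κ ℝ, P ≠ 0 ∧ P.IsHomogeneous k ∧
      g - aeval y P ∈ F ⊔ 𝔪 ^ (k + 1) := by
  classical
  by_contra! H
  refine hg (Ideal.mem_saturationAt_of_forall_mem_sup_pow fun k => ?_)
  induction k with
  | zero => simp
  | succ k ih =>
    obtain ⟨u, hu, v, hv, rfl⟩ := Submodule.mem_sup.1 ih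
    obtain ⟨P, hP, hPv⟩ := h.exists_isHomogeneous hv
    have huv : u + v - aeval y P ∈ F ⊔ 𝔪 ^ (k + 1) := by
      rw [add_sub_assoc]; exact add_mem (Ideal.mem_sup_left hu) hPv
    by_cases hP0 : P = 0
    · simpa [hP0] using huv
    · exact absurd huv (H k P hP0 hP)

lemma card_eq (h : IsCoordinateSystemAt x f y) :
    Fintype.card ι + Fintype.card κ = Fintype.card σ := by
  have := Module.finrank_eq_card_basis (Module.Basis.mk h.linearIndependent h.span_eq_top.ge)
  simpa using this.symm

lemma exists_localInverse (h : IsCoordinateSystemAt x f y) :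
    ∃ ψ : (ι ⊕ κ → ℝ) → σ → ℝ, ψ 0 = x ∧ ((fun u => ψ u - x) =O[𝓝 0] fun u => u) ∧
      ∀ᶠ u in 𝓝 0, ∀ s, eval (ψ u) (Sum.elim f y s) = u s := by
  classical
  let L : (σ → ℝ) →L[ℝ] (ι ⊕ κ → ℝ) := ContinuousLinearMap.pi fun s => ∑ i,
    gradientAt x (Sum.elim f y s) i • ContinuousLinearMap.proj (R := ℝ) (φ := fun _ : σ => ℝ) i
  have hL : Function.Injective (L : (σ → ℝ) →ₗ[ℝ] (ι ⊕ κ → ℝ)) := by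
    rw [← LinearMap.ker_eq_bot, LinearMap.ker_eq_bot']
    intro v hv
    have hle : Submodule.span ℝ (Set.range fun s => gradientAt x (Sum.elim f y s)) ≤
        LinearMap.ker (dotProductBilin ℝ ℝ v) := by
      rw [Submodule.span_le]
      rintro _ ⟨s, rfl⟩
      have := congrFun hv s
      simp only [L] at this
      simpa [dotProduct, mul_comm] using this
    rw [h.span_eq_top] at hle
    have : v ⬝ᵥ v = 0 := by simpa using hle (Submodule.mem_top (x := v))
    exact dotProduct_self_eq_zero.1 this
  let e : (σ → ℝ) ≃L[ℝ] (ι ⊕ κ → ℝ) := (LinearMap.linearEquivOfInjective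
    (L : (σ → ℝ) →ₗ[ℝ] (ι ⊕ κ → ℝ)) hL (by simp [← h.card_eq])).toContinuousLinearEquiv
  have hG : HasStrictFDerivAt (fun z s => eval z (Sum.elim f y s))
      (e : (σ → ℝ) →L[ℝ] (ι ⊕ κ → ℝ)) x := by
    have he : (e : (σ → ℝ) →L[ℝ] (ι ⊕ κ → ℝ)) = L := by ext; rfl
    rw [he]
    exact hasStrictFDerivAt_pi.2 fun s => hasStrictFDerivAt_eval x _
  have hx : (fun s => eval x (Sum.elim f y s)) = 0 := by
    ext (i | j)
    · simpa using h.eval_left i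
    · simpa using h.eval_right j
  have h1 := hG.to_localInverse.hasFDerivAt.isBigO_sub
  have h2 := hG.eventually_right_inverse
  have h3 := hG.localInverse_apply_image
  rw [hx] at h1 h2 h3
  refine ⟨hG.localInverse _ _ _, h3, by simpa [h3] using h1, ?_⟩
  filter_upwards [h2] with u hu s using congrFun hu s

/-- The leading form of a polynomial vanishing on the zero set of `f` near `x` is zero. -/
lemma leading_form_eq_zero (h : IsCoordinateSystemAt x f y) {k : ℕ} {P : MvPolynomial κ ℝ}
    {g : MvPolynomial σ ℝ} (hP : P.IsHomogeneous k) (hgP : g - aeval y P ∈ F ⊔ 𝔪 ^ (k + 1))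
    (hg : ∀ᶠ z in 𝓝 x, (∀ i, eval z (f i) = 0) → eval z g = 0) : P = 0 := by
  obtain ⟨ψ, hψ0, hψO, hψ⟩ := h.exists_localInverse
  refine MvPolynomial.funext fun w => ?_
  rw [map_zero]
  let u : ℝ → ι ⊕ κ → ℝ := fun t => t • Sum.elim (0 : ι → ℝ) w
  have hu : Tendsto u (𝓝 0) (𝓝 0) := by
    have : Continuous u := by fun_prop
    simpa [u] using this.tendsto 0
  have huO : (fun t => ψ (u t) - x) =O[𝓝 0] fun t : ℝ => t := by
    refine (hψO.comp_tendsto hu).trans (IsBigO.of_bound ‖Sum.elim (0 : ι → ℝ) w‖ ?_)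
    exact Eventually.of_forall fun t => by simp [u, norm_smul, mul_comm]
  have hlim : Tendsto (fun t => ψ (u t)) (𝓝 0) (𝓝 x) := by
    simpa using (huO.trans_tendsto tendsto_id).add_const x
  obtain ⟨a, ha, b, hb, hab⟩ := Submodule.mem_sup.1 hgP
  have hbO : (fun t => eval (ψ (u t)) b) =O[𝓝 0] fun t : ℝ => t ^ (k + 1) :=
    ((isBigO_of_mem_ker_eval_pow hb).comp_tendsto hlim).trans (huO.norm_left.pow (k + 1))
  have hPO : (fun t : ℝ => t ^ k * eval w P) =O[𝓝 0] fun t : ℝ => t ^ (k + 1) := by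
    refine hbO.neg_left.congr' ?_ EventuallyEq.rfl
    filter_upwards [hlim.eventually hg, hu.eventually hψ] with t ht1 ht2
    have hf0 : ∀ i, eval (ψ (u t)) (f i) = 0 := fun i => by simpa [u] using ht2 (.inl i)
    have hy0 : (fun j => eval (ψ (u t)) (y j)) = t • w := by
      ext j; simpa [u] using ht2 (.inr j)
    have ha0 : eval (ψ (u t)) a = 0 := by
      have : F ≤ RingHom.ker (eval (ψ (u t))) := by
        rw [Ideal.span_le]
        rintro _ ⟨i, rfl⟩
        exact hf0 i
      exact this ha
    have hPe : eval (ψ (u t)) (aeval y P) = t ^ k * eval w P := by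
      rw [← hP.eval_smul, ← hy0, ← aeval_eq_eval, ← aeval_eq_eval, aeval_eq_bind₁, aeval_bind₁]
    have := congrArg (eval (ψ (u t))) hab
    rw [map_add, map_sub, ht1 hf0, ha0, hPe] at this
    linarith
  have h1 : (fun _ : ℝ => eval w P) =O[𝓝[≠] 0] fun t : ℝ => t := by
    refine ((isBigO_refl (fun t : ℝ => (t ^ k)⁻¹) _).mul (hPO.mono nhdsWithin_le_nhds)).congr' ?_ ?_
    · filter_upwards [self_mem_nhdsWithin] with t (ht : t ≠ 0)
      field_simp
    · filter_upwards [self_mem_nhdsWithin] with t (ht : t ≠ 0)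
      field_simp
      ring
  exact tendsto_nhds_unique tendsto_const_nhds
    (h1.trans_tendsto (tendsto_id.mono_left nhdsWithin_le_nhds))

lemma mem_saturationAt_iff (h : IsCoordinateSystemAt x f y) {g : MvPolynomial σ ℝ} :
    g ∈ (F).saturationAt 𝔪 ↔ ∀ᶠ z in 𝓝 x, (∀ i, eval z (f i) = 0) → eval z g = 0 := by
  refine ⟨eventually_eval_eq_zero, fun hg => ?_⟩
  by_contra hn
  obtain ⟨k, P, hP0, hP, hgP⟩ := h.exists_leading_form hn
  exact hP0 (h.leading_form_eq_zero hP hgP hg)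

lemma saturationAt_le (h : IsCoordinateSystemAt x f y) : (F).saturationAt 𝔪 ≤ 𝔪 := fun _ hg =>
  (h.mem_saturationAt_iff.1 hg).self_of_nhds h.eval_left

lemma isPrime_saturationAt (h : IsCoordinateSystemAt x f y) :
    ((F).saturationAt 𝔪).IsPrime := by
  refine ⟨fun H => ?_, fun {a b} hab => ?_⟩
  · have := h.saturationAt_le (H ▸ Submodule.mem_top : (1 : MvPolynomial σ ℝ) ∈ _)
    simp [RingHom.mem_ker] at this
  · by_contra! H
    obtain ⟨i, P, hP0, hP, haP⟩ := h.exists_leading_form H.1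
    obtain ⟨j, Q, hQ0, hQ, hbQ⟩ := h.exists_leading_form H.2
    exact mul_ne_zero hP0 hQ0 (h.leading_form_eq_zero (hP.mul hQ)
      (h.mul_sub_aeval_mem hP hQ haP hbQ) (h.mem_saturationAt_iff.1 hab))

lemma ker_eval_le_of_isPrime (h : IsCoordinateSystemAt x f y) {P : Ideal (MvPolynomial σ ℝ)}
    [hP : P.IsPrime] (hP𝔪 : P ≤ 𝔪) (hf : F ≤ P) (hy : Ideal.span (Set.range y) ≤ P) : 𝔪 ≤ P := by
  have hle : 𝔪 ≤ P ⊔ (𝔪 • 𝔪 : Ideal (MvPolynomial σ ℝ)) := by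
    intro a ha
    obtain ⟨Q, hQ, haQ⟩ := h.exists_linear ha
    have hQy : aeval y Q ∈ Ideal.span (Set.range y) ^ 1 :=
      hQ.aeval_mem_pow fun j => Ideal.subset_span ⟨j, rfl⟩
    rw [pow_one] at hQy
    rw [pow_two] at haQ
    simpa using add_mem (sup_le_sup_right hf _ haQ) (Ideal.mem_sup_left (hy hQy))
  obtain ⟨r, hr, hrm⟩ := Submodule.exists_sub_one_mem_and_smul_le_of_fg_of_le_sup
    (IsNoetherian.noetherian 𝔪) le_rfl hle
  intro a ha
  refine (hP.mem_or_mem (hrm (Submodule.smul_mem_pointwise_smul a r _ ha))).resolve_left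
    fun hrP => ?_
  have : (1 : MvPolynomial σ ℝ) ∈ 𝔪 := by simpa using sub_mem (hP𝔪 hrP) hr
  simp [RingHom.mem_ker] at this

lemma height_map_ker_eval_le (h : IsCoordinateSystemAt x f y) :
    ((𝔪).map (Ideal.Quotient.mk ((F).saturationAt 𝔪))).height ≤ Fintype.card κ := by
  classical
  have hmax : ((𝔪).map (Ideal.Quotient.mk ((F).saturationAt 𝔪))).IsMaximal :=
    Ideal.IsMaximal.map_of_surjective_of_ker_le Ideal.Quotient.mk_surjective
      (by simpa using h.saturationAt_le)
  set π := Ideal.Quotient.mk ((F).saturationAt 𝔪)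
  have hmin : (𝔪).map π ∈
      (Ideal.span (Finset.univ.image (fun j => π (y j)) :
        Set (_ ⧸ (F).saturationAt 𝔪))).minimalPrimes := by
    refine ⟨⟨hmax.isPrime, ?_⟩, fun P hP hPm => ?_⟩
    · rw [Ideal.span_le]
      intro z hz
      obtain ⟨j, rfl⟩ : ∃ j, π (y j) = z := by simpa using hz
      exact Ideal.mem_map_of_mem _ ((RingHom.mem_ker).2 (h.eval_right j))
    · have hP1 : P.IsPrime := hP.1
      have := Ideal.comap_isPrime π P
      rw [Ideal.map_le_iff_le_comap]
      refine h.ker_eval_le_of_isPrime ?_ ?_ ?_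
      · exact (Ideal.comap_mono hPm).trans (Ideal.comap_map_mk h.saturationAt_le).le
      · refine (Ideal.le_saturationAt F 𝔪).trans fun a ha => ?_
        rw [Ideal.mem_comap, Ideal.Quotient.eq_zero_iff_mem.2 ha]
        exact zero_mem _
      · rw [Ideal.span_le]
        rintro _ ⟨j, rfl⟩
        exact hP.2 (Ideal.subset_span (by simp))
  refine (Ideal.height_le_card_of_mem_minimalPrimes_span_finset hmin).trans ?_
  exact_mod_cast Finset.card_image_le.trans (by simp)

/-- If `f` belongs to a prime ideal of the right dimension, then it generates this ideal locally. -/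
lemma le_saturationAt (h : IsCoordinateSystemAt x f y) {I : Ideal (MvPolynomial σ ℝ)}
    [hI : I.IsPrime] (hI𝔪 : I ≤ 𝔪) (hf : F ≤ I)
    (hdim : (Fintype.card κ : WithBot ℕ∞) ≤ ringKrullDim (MvPolynomial σ ℝ ⧸ I)) :
    I ≤ (F).saturationAt 𝔪 := by
  have hJI : (F).saturationAt 𝔪 ≤ I := Ideal.saturationAt_le_of_isPrime hf hI𝔪
  by_contra hn
  obtain ⟨g, hgI, hgJ⟩ := SetLike.not_le_iff_exists.1 hn
  have hJ := h.isPrime_saturationAt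
  have hmax : ((𝔪).map (Ideal.Quotient.mk ((F).saturationAt 𝔪))).IsMaximal :=
    Ideal.IsMaximal.map_of_surjective_of_ker_le Ideal.Quotient.mk_surjective
      (by simpa using h.saturationAt_le)
  have h1 := ringKrullDim_succ_le_of_surjective (Ideal.Quotient.factor hJI)
    (Ideal.Quotient.factor_surjective hJI) (r := Ideal.Quotient.mk _ g)
    (mem_nonZeroDivisors_of_ne_zero (by rwa [Ne, Ideal.Quotient.eq_zero_iff_mem]))
    (by simpa [Ideal.Quotient.eq_zero_iff_mem] using hgI)
  have h2 := ringKrullDim_le_height_of_isMaximal ℝ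
    ((𝔪).map (Ideal.Quotient.mk ((F).saturationAt 𝔪)))
  have h3 : (Fintype.card κ : WithBot ℕ∞) + 1 ≤ (Fintype.card κ : ℕ∞) :=
    (add_le_add_left hdim 1).trans (h1.trans (h2.trans
      (by exact_mod_cast h.height_map_ker_eval_le)))
  have h4 : Fintype.card κ + 1 ≤ Fintype.card κ := by exact_mod_cast h3
  omega

lemma eventually_eval_eq_zero_of_le (h : IsCoordinateSystemAt x f y) {I : Ideal (MvPolynomial σ ℝ)}
    (hI : I ≤ (F).saturationAt 𝔪) :
    ∀ᶠ z in 𝓝 x, (∀ i, eval z (f i) = 0) → ∀ g ∈ I, eval z g = 0 := by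
  obtain ⟨s, rfl⟩ := IsNoetherian.noetherian I
  have hs : ∀ g ∈ s, ∀ᶠ z in 𝓝 x, (∀ i, eval z (f i) = 0) → eval z g = 0 := fun g hg =>
    h.mem_saturationAt_iff.1 (hI (Ideal.subset_span hg))
  filter_upwards [(Filter.eventually_all_finset s).2 hs] with z hz hfz g hg
  have hle : Ideal.span (s : Set (MvPolynomial σ ℝ)) ≤ RingHom.ker (eval z) :=
    Ideal.span_le.2 fun g hg => hz g hg hfz
  exact hle hg

end IsCoordinateSystemAt

lemma exists_isCoordinateSystemAt {σ ι : Type*} [Fintype σ] {x : σ → ℝ}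
    {f : ι → MvPolynomial σ ℝ} (hf : ∀ i, eval x (f i) = 0)
    (hli : LinearIndependent ℝ fun i => gradientAt x (f i)) :
    ∃ (κ : Set (σ → ℝ)) (y : κ → MvPolynomial σ ℝ), κ.Finite ∧ IsCoordinateSystemAt x f y := by
  classical
  let b := Module.Basis.sumExtend hli
  let y : Module.Basis.sumExtendIndex hli → MvPolynomial σ ℝ :=
    fun j => ∑ i, C (b (.inr j) i) * (X i - C (x i))
  have hb : (fun s => gradientAt x (Sum.elim f y s)) = b := by
    ext (i | j) k
    · simp [b, Module.Basis.sumExtend]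
      rfl
    · simp [y, gradientAt, pderiv_X, Pi.single_apply]
  have : Finite (ι ⊕ Module.Basis.sumExtendIndex hli) := Module.Finite.finite_basis b
  refine ⟨_, y, Set.finite_coe_iff.1 (Finite.sum_right ι), hf, fun j => by simp [y], ?_, ?_⟩
  · rw [hb]; exact b.linearIndependent
  · rw [hb]; exact b.span_eq

lemma _root_.Matrix.range_mulVecLin_eq_top {σ ι K : Type*} [Fintype σ] [Fintype ι] [Field K]
    {M : Matrix ι σ K} (hM : LinearIndependent K M.row) : M.mulVecLin.range = ⊤ :=
  Submodule.eq_top_of_finrank_eq (by simpa [Matrix.rank] using hM.rank_matrix)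

lemma _root_.Submodule.exists_fun_fin_span_eq_of_finrank_eq {K V : Type*} [DivisionRing K]
    [AddCommGroup V] [Module K V] [Module.Finite K V] {s : Set V} {c : ℕ}
    (hc : Module.finrank K (Submodule.span K s) = c) :
    ∃ v : Fin c → V, (∀ i, v i ∈ s) ∧ Submodule.span K (Set.range v) = Submodule.span K s ∧
      LinearIndependent K v := by
  subst hc
  exact Submodule.exists_fun_fin_finrank_span_eq K s

/-- If the derivatives of `f` in the directions `q` span, then the zero set of `f` near `x` contains
points outside of the affine space through `x` in the directions `q`. -/
lemma exists_eval_add_smul_eq_zero {σ ι τ : Type*} [Fintype σ] [Fintype ι] [Fintype τ]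
    {x : σ → ℝ} {f : ι → MvPolynomial σ ℝ} (hf : ∀ i, eval x (f i) = 0) {q : τ → σ → ℝ}
    (hq : Submodule.span ℝ (Set.range fun j i => ∑ k, gradientAt x (f i) k * q j k) = ⊤)
    (p : σ → ℝ) {U : Set (σ → ℝ)} (hU : U ∈ 𝓝 x) :
    ∃ (a : τ → ℝ) (s : ℝ), s ≠ 0 ∧ x + (∑ j, a j • q j + s • p) ∈ U ∧
      ∀ i, eval (x + (∑ j, a j • q j + s • p)) (f i) = 0 := by
  classical
  let D : (σ → ℝ) →L[ℝ] (ι → ℝ) := ContinuousLinearMap.pi fun i => ∑ k,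
    gradientAt x (f i) k • ContinuousLinearMap.proj (R := ℝ) (φ := fun _ : σ => ℝ) k
  have hD : ∀ v i, D v i = ∑ k, gradientAt x (f i) k * v k := fun v i => by simp [D]
  let L : (τ → ℝ) × ℝ →L[ℝ] (σ → ℝ) :=
    (∑ j, (ContinuousLinearMap.proj (R := ℝ) (φ := fun _ : τ => ℝ) j).smulRight (q j)).comp
      (ContinuousLinearMap.fst ℝ (τ → ℝ) ℝ) + (ContinuousLinearMap.snd ℝ (τ → ℝ) ℝ).smulRight p
  have hL : ∀ v, L v = ∑ j, v.1 j • q j + v.2 • p := fun v => by simp [L]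
  have hadd : HasStrictFDerivAt (fun v => x + L v) L 0 := L.hasStrictFDerivAt.const_add x
  have hfx : HasStrictFDerivAt (fun z i => eval z (f i)) D (x + L 0) := by
    rw [map_zero, add_zero]
    exact hasStrictFDerivAt_pi.2 fun i => hasStrictFDerivAt_eval x _
  have hΨ : HasStrictFDerivAt (fun v : (τ → ℝ) × ℝ => ((fun i => eval (x + L v) (f i)), v.2))
      ((D.comp L).prod (ContinuousLinearMap.snd ℝ (τ → ℝ) ℝ)) 0 :=
    (hfx.comp (0 : (τ → ℝ) × ℝ) hadd).prodMk hasStrictFDerivAt_snd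
  have hsurj : (((D.comp L).prod (ContinuousLinearMap.snd ℝ (τ → ℝ) ℝ) :
      (τ → ℝ) × ℝ →L[ℝ] (ι → ℝ) × ℝ) : (τ → ℝ) × ℝ →ₗ[ℝ] (ι → ℝ) × ℝ).range = ⊤ := by
    rw [LinearMap.range_eq_top]
    rintro ⟨u, s⟩
    have hu : u - s • D p ∈
        Submodule.span ℝ (Set.range fun j i => ∑ k, gradientAt x (f i) k * q j k) := by
      rw [hq]; trivial
    obtain ⟨a, ha⟩ := (Submodule.mem_span_range_iff_exists_fun ℝ).1 hu
    refine ⟨(a, s), Prod.ext ?_ rfl⟩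
    have hDq : ∀ j, D (q j) = fun i => ∑ k, gradientAt x (f i) k * q j k := fun j => by
      ext i; rw [hD]
    simp [hL, hDq, ha]
  have hmap := hΨ.map_nhds_eq_of_surj hsurj
  simp only [map_zero, add_zero, hf, Prod.snd_zero] at hmap
  have hUL : {v | x + L v ∈ U} ∈ 𝓝 (0 : (τ → ℝ) × ℝ) :=
    hadd.continuousAt.preimage_mem_nhds (by simpa using hU)
  have himg := image_mem_map (m := fun v : (τ → ℝ) × ℝ =>
    ((fun i => eval (x + L v) (f i)), v.2)) hUL
  rw [hmap] at himg
  have hc : Tendsto (fun s : ℝ => ((fun _ => 0 : ι → ℝ), s)) (𝓝[≠] 0) (𝓝 (fun _ => 0, 0)) :=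
    ((by fun_prop : Continuous fun s : ℝ => ((fun _ => 0 : ι → ℝ), s)).tendsto 0).mono_left
      nhdsWithin_le_nhds
  obtain ⟨s, ⟨v, hv, hvs⟩, hs⟩ := ((hc.eventually himg).and self_mem_nhdsWithin).exists
  obtain ⟨h1, h2⟩ := Prod.ext_iff.1 hvs
  refine ⟨v.1, v.2, by rw [show v.2 = s from h2]; exact hs, ?_, fun i => ?_⟩
  · rw [← hL]; exact hv
  · rw [← hL]; exact congrFun h1 i

end MvPolynomial

lemma realRank_le_of_sum {V : Type*} [AddCommMonoid V] {S : Set V} {p : V} {r : ℕ} {v : Fin r → V}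
    (hv : ∀ i, v i ∈ S) (hp : ∑ i, v i = p) : realRank S p ≤ r :=
  sInf_le ⟨r, ⟨v, hv, hp⟩, rfl⟩

lemma smul_mem_realVariety {n : ℕ} {I : Ideal (MvPolynomial (Fin (n + 1)) ℝ)}
    (hhom : ∀ f ∈ I, ∀ d : ℕ, homogeneousComponent d f ∈ I) {z : Fin (n + 1) → ℝ}
    (hz : z ∈ realVariety I) (t : ℝ) : t • z ∈ realVariety I := by
  intro g hg
  rw [← sum_homogeneousComponent g, map_sum]
  refine Finset.sum_eq_zero fun d _ => ?_
  rw [(homogeneousComponent_isHomogeneous d g).eval_smul, hz _ (hhom g hg d), mul_zero]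

open Filter Topology in
lemma span_realVariety_eq_top {n : ℕ} {I : Ideal (MvPolynomial (Fin (n + 1)) ℝ)}
    [hI : I.IsPrime]
    (hnondeg : ∀ f ∈ I, f ∈ homogeneousSubmodule (Fin (n + 1)) ℝ 1 → f = 0)
    {ι κ : Type*} [Fintype ι] [Fintype κ] {x : Fin (n + 1) → ℝ}
    {f : ι → MvPolynomial (Fin (n + 1)) ℝ} {y : κ → MvPolynomial (Fin (n + 1)) ℝ}
    (h : IsCoordinateSystemAt x f y) (hf : Ideal.span (Set.range f) ≤ I)
    (hx : I ≤ RingHom.ker (eval x))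
    (hloc : ∀ᶠ z in 𝓝 x, (∀ i, eval z (f i) = 0) → z ∈ realVariety I) :
    Submodule.span ℝ (realVariety I) = ⊤ := by
  by_contra hne
  obtain ⟨φ, hφ0, hφ⟩ := Submodule.exists_le_ker_of_lt_top _ (lt_top_iff_ne_top.2 hne)
  let ℓ : MvPolynomial (Fin (n + 1)) ℝ := ∑ i, C (φ fun j => if i = j then 1 else 0) * X i
  have hℓ : ∀ z, eval z ℓ = φ z := fun z => by
    rw [LinearMap.pi_apply_eq_sum_univ φ z]
    simp [ℓ, mul_comm]
  have hℓI : ℓ ∈ I := by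
    refine Ideal.saturationAt_le_of_isPrime hf hx (h.mem_saturationAt_iff.2 ?_)
    filter_upwards [hloc] with z hz hfz
    rw [hℓ]
    exact hφ (Submodule.subset_span (hz hfz))
  have hℓ0 := hnondeg ℓ hℓI ((mem_homogeneousSubmodule _ _).2 (IsHomogeneous.sum _ _ _ fun i _ => by
    simpa using (isHomogeneous_C _ (φ fun j => if i = j then 1 else 0)).mul (isHomogeneous_X ℝ i)))
  exact hφ0 (LinearMap.ext fun z => by rw [← hℓ, hℓ0, map_zero, LinearMap.zero_apply])

/-- If `I` is a homogeneous prime ideal of `ℝ[x₀,…,x_n]` containing no nonzero linear form,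
with Krull dimension of the quotient equal to `m + 1` (i.e. `I` defines an irreducible
nondegenerate projective variety of dimension `m`), having a smooth real point, then the
real rank of any nonzero `p ∈ ℝ^{n+1}` with respect to `V_ℝ(I)` is at most `n - m + 2`. -/
theorem statement0 (n m : ℕ) (hn : 1 ≤ n) (hm1 : 1 ≤ m) (hmn : m ≤ n)
    (I : Ideal (MvPolynomial (Fin (n + 1)) ℝ))
    (hhom : ∀ f ∈ I, ∀ d : ℕ, (homogeneousComponent d f) ∈ I)
    (hprime : I.IsPrime)
    (hnondeg : ∀ f ∈ I, f ∈ homogeneousSubmodule (Fin (n + 1)) ℝ 1 → f = 0)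
    (hdim : ringKrullDim (MvPolynomial (Fin (n + 1)) ℝ ⧸ I) = (m + 1 : ℕ))
    (hsmooth : ∃ x : Fin (n + 1) → ℝ, x ≠ 0 ∧ x ∈ realVariety I ∧
      Module.finrank ℝ (Submodule.span ℝ
        {g : Fin (n + 1) → ℝ | ∃ f ∈ I, g = fun i => eval x (pderiv i f)}) = n - m)
    (p : Fin (n + 1) → ℝ) (hp : p ≠ 0) :
    realRank (realVariety I) p ≤ (n - m + 2 : ℕ) := by
  obtain ⟨x, -, hxI, hrank⟩ := hsmooth
  have hx𝔪 : I ≤ RingHom.ker (eval x) := fun g hg => hxI g hg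
  obtain ⟨v, hv, -, hvli⟩ := Submodule.exists_fun_fin_span_eq_of_finrank_eq hrank
  choose f hfI hfv using hv
  have hgrad : (fun i => gradientAt x (f i)) = v := funext fun i => (hfv i).symm
  have hf0 : ∀ i, eval x (f i) = 0 := fun i => hxI _ (hfI i)
  have hfle : Ideal.span (Set.range f) ≤ I := by
    rw [Ideal.span_le]
    rintro _ ⟨i, rfl⟩
    exact hfI i
  obtain ⟨κ, y, hκ, hcoord⟩ := exists_isCoordinateSystemAt hf0 (hgrad ▸ hvli)
  have := hκ.fintype
  have hcard : Fintype.card κ = m + 1 := by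
    have := hcoord.card_eq
    simp only [Fintype.card_fin] at this
    omega
  have hloc := hcoord.eventually_eval_eq_zero_of_le
    (hcoord.le_saturationAt hx𝔪 hfle (by rw [hdim, hcard]))
  have hspan := span_realVariety_eq_top hnondeg hcoord hfle hx𝔪 hloc
  have hMspan : Submodule.span ℝ ((Matrix.of v).mulVecLin '' realVariety I) = ⊤ := by
    rw [Submodule.span_image, hspan, Submodule.map_top,
      Matrix.range_mulVecLin_eq_top (M := Matrix.of v) hvli]
  obtain ⟨q', hq', hqspan, -⟩ := Submodule.exists_fun_fin_span_eq_of_finrank_eq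
    (show Module.finrank ℝ
      (Submodule.span ℝ ((Matrix.of v).mulVecLin '' realVariety I)) = n - m by
        rw [hMspan, finrank_top, Module.finrank_fin_fun])
  choose q hqI hqv using hq'
  have hq : Submodule.span ℝ (Set.range fun j i => ∑ k, gradientAt x (f i) k * q j k) = ⊤ := by
    rw [← hMspan, ← hqspan]
    congr 2
    ext j i
    rw [← hqv, ← hgrad]
    rfl
  obtain ⟨a, s, hs, hz, hfz⟩ := exists_eval_add_smul_eq_zero hf0 hq p hloc
  set z := x + (∑ j, a j • q j + s • p) with hzdef
  refine realRank_le_of_sum (v := Fin.cons (s⁻¹ • z) (Fin.cons ((-s⁻¹) • x)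
    fun j => (-s⁻¹ * a j) • q j)) (Fin.cons ?_ (Fin.cons ?_ fun j => ?_)) ?_
  · exact smul_mem_realVariety hhom (hz hfz) _
  · exact smul_mem_realVariety hhom hxI _
  · exact smul_mem_realVariety hhom (hqI j) _
  · rw [Fin.sum_cons, Fin.sum_cons, hzdef]
    simp only [mul_smul, neg_smul, smul_add, Finset.sum_neg_distrib, Finset.smul_sum,
      inv_smul_smul₀ hs]
    abel
end

section
/- For all integers d ≥ 1 and c ≥ 1 there exist a homogeneous ideal I ⊆ ℝ[x₀,…,x_{d+c}] defining an irreducible nondegenerate projective variety of dimension d with a smooth real point, a nonzero point p ∈ ℝ^{d+c+1}, and a Euclidean-open neighborhood U ⊆ ℝ^{d+c+1} of p such that every q ∈ U has real rank exactly c + 2 with respect to V_ℝ(I). -/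
open scoped BigOperators
open MvPolynomial

/-- `DivDiff k m M g`: the function `g` on the circle behaves like a form of degree `k` whose
divided differences up to order `m` exist and are bounded by `M`. -/
def DivDiff : ℕ → ℕ → ℝ → (ℝ → ℝ) → Prop
  | _, 0, M, g => ∀ θ, |g θ| ≤ M
  | 0, _ + 1, M, g => (∀ θ, |g θ| ≤ M) ∧ ∀ θ θ₀, g θ = g θ₀
  | k + 1, m + 1, M, g => (∀ θ, |g θ| ≤ M) ∧ ∀ θ₀, ∃ h, DivDiff k m M h ∧
      ∀ θ, g θ = g θ₀ * Real.cos (θ - θ₀) ^ (k + 1) + Real.sin (θ - θ₀) * h θ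

namespace DivDiff

lemma bound {k m : ℕ} {M : ℝ} {g : ℝ → ℝ} (h : DivDiff k m M g) (θ : ℝ) : |g θ| ≤ M := by
  rcases m with _ | m
  · simp only [DivDiff] at h; exact h θ
  · rcases k with _ | k <;> simp only [DivDiff] at h <;> exact h.1 θ

lemma mono {k m : ℕ} {M N : ℝ} (hMN : M ≤ N) {g : ℝ → ℝ} (h : DivDiff k m M g) :
    DivDiff k m N g := by
  induction m generalizing k g with
  | zero => simp only [DivDiff] at h ⊢; exact fun θ => (h θ).trans hMN
  | succ m ih =>
    rcases k with _ | k <;> simp only [DivDiff] at h ⊢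
    · exact ⟨fun θ => (h.1 θ).trans hMN, h.2⟩
    · refine ⟨fun θ => (h.1 θ).trans hMN, fun θ₀ => ?_⟩
      obtain ⟨u, hu, hg⟩ := h.2 θ₀
      exact ⟨u, ih hu, hg⟩

lemma of_succ {k m : ℕ} {M : ℝ} {g : ℝ → ℝ} (h : DivDiff k (m + 1) M g) : DivDiff k m M g := by
  induction m generalizing k g with
  | zero => simp only [DivDiff]; exact h.bound
  | succ m ih =>
    rcases k with _ | k <;> rw [DivDiff] at h ⊢
    · exact h
    · refine ⟨h.1, fun θ₀ => ?_⟩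
      obtain ⟨u, hu, hg⟩ := h.2 θ₀
      exact ⟨u, ih hu, hg⟩

lemma add {k m : ℕ} {M N : ℝ} {g h : ℝ → ℝ} (hg : DivDiff k m M g) (hh : DivDiff k m N h) :
    DivDiff k m (M + N) (fun θ => g θ + h θ) := by
  have hb : ∀ θ, |g θ + h θ| ≤ M + N :=
    fun θ => (abs_add_le _ _).trans (add_le_add (hg.bound θ) (hh.bound θ))
  induction m generalizing k g h with
  | zero => simpa only [DivDiff] using hb
  | succ m ih =>
    rcases k with _ | k <;> rw [DivDiff] at hg hh ⊢
    · exact ⟨hb, fun θ θ₀ => by rw [hg.2 θ θ₀, hh.2 θ θ₀]⟩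
    · refine ⟨hb, fun θ₀ => ?_⟩
      obtain ⟨u, hu, hgu⟩ := hg.2 θ₀
      obtain ⟨v, hv, hhv⟩ := hh.2 θ₀
      refine ⟨_, ih hu hv fun θ => (abs_add_le _ _).trans
        (add_le_add (hu.bound θ) (hv.bound θ)), fun θ => ?_⟩
      rw [hgu θ, hhv θ]
      ring

lemma const_mul {k m : ℕ} {M K a : ℝ} (ha : |a| ≤ K) {g : ℝ → ℝ} (hg : DivDiff k m M g) :
    DivDiff k m (K * M) (fun θ => a * g θ) := by
  have key : ∀ {f : ℝ → ℝ}, (∀ θ, |f θ| ≤ M) → ∀ θ, |a * f θ| ≤ K * M := fun hf θ => by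
    rw [abs_mul]
    exact mul_le_mul ha (hf θ) (abs_nonneg _) ((abs_nonneg _).trans ha)
  induction m generalizing k g with
  | zero => simpa only [DivDiff] using key hg.bound
  | succ m ih =>
    rcases k with _ | k <;> rw [DivDiff] at hg ⊢
    · exact ⟨key hg.1, fun θ θ₀ => by rw [hg.2 θ θ₀]⟩
    · refine ⟨key hg.1, fun θ₀ => ?_⟩
      obtain ⟨u, hu, hgu⟩ := hg.2 θ₀
      refine ⟨_, ih hu, fun θ => ?_⟩
      rw [hgu θ]
      ring

lemma const (m : ℕ) {a M : ℝ} (ha : |a| ≤ M) : DivDiff 0 m M fun _ => a := by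
  rcases m with _ | m <;> simp [DivDiff, ha]

lemma cos_sub (m : ℕ) (φ : ℝ) : DivDiff 1 m 1 fun θ => Real.cos (θ - φ) := by
  rcases m with _ | m <;> simp only [DivDiff]
  · exact fun θ => Real.abs_cos_le_one _
  · refine ⟨fun θ => Real.abs_cos_le_one _, fun θ₀ => ⟨fun _ => -Real.sin (θ₀ - φ),
      const m (by rw [abs_neg]; exact Real.abs_sin_le_one _), fun θ => ?_⟩⟩
    rw [show θ - φ = (θ - θ₀) + (θ₀ - φ) by ring, Real.cos_add]
    ring

private lemma exists_pow_of_mul {m : ℕ}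
    (hmul : ∀ (k l : ℕ) (M N : ℝ), ∃ K, ∀ g h, DivDiff k m M g → DivDiff l m N h →
      DivDiff (k + l) m K fun θ => g θ * h θ) (k : ℕ) :
    ∃ K, ∀ φ, DivDiff k m K fun θ => Real.cos (θ - φ) ^ k := by
  induction k with
  | zero => exact ⟨1, fun φ => by simpa using const m (a := 1) (by simp)⟩
  | succ k ih =>
    obtain ⟨K, hK⟩ := ih
    obtain ⟨L, hL⟩ := hmul k 1 K 1
    exact ⟨L, fun φ => by simpa only [pow_succ] using hL _ _ (hK φ) (cos_sub m φ)⟩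

lemma exists_mul (m k l : ℕ) (M N : ℝ) : ∃ K, ∀ g h, DivDiff k m M g → DivDiff l m N h →
    DivDiff (k + l) m K fun θ => g θ * h θ := by
  have hb : ∀ {x y : ℝ} {M N : ℝ}, |x| ≤ M → |y| ≤ N → |x * y| ≤ M * N := fun hx hy => by
    rw [abs_mul]
    exact mul_le_mul hx hy (abs_nonneg _) ((abs_nonneg _).trans hx)
  induction m generalizing k l M N with
  | zero =>
    refine ⟨M * N, fun g h hg hh => ?_⟩
    simp only [DivDiff] at hg hh ⊢
    exact fun θ => hb (hg θ) (hh θ)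
  | succ m ih =>
    rcases k with _ | k
    · refine ⟨M * N, fun g h hg hh => ?_⟩
      have := const_mul (hg.bound 0) hh
      rw [DivDiff] at hg
      simpa only [hg.2 _ 0, Nat.zero_add] using this
    rcases l with _ | l
    · refine ⟨N * M, fun g h hg hh => ?_⟩
      have := const_mul (hh.bound 0) hg
      rw [DivDiff] at hh
      simpa only [hh.2 _ 0, Nat.add_zero, mul_comm (g _)] using this
    obtain ⟨P, hP⟩ := exists_pow_of_mul ih (k + 1)
    obtain ⟨K₁, hK₁⟩ := ih (k + 1) l P N
    obtain ⟨K₂, hK₂⟩ := ih k (l + 1) M N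
    refine ⟨max (M * N) (M * K₁ + K₂), fun g h hg hh => ?_⟩
    have hh' := hh.of_succ
    rw [show k + 1 + (l + 1) = (k + 1 + l) + 1 by ring]
    rw [DivDiff] at hg hh ⊢
    refine ⟨fun θ => (hb (hg.1 θ) (hh.1 θ)).trans (le_max_left _ _), fun θ₀ => ?_⟩
    obtain ⟨u, hu, hgu⟩ := hg.2 θ₀
    obtain ⟨v, hv, hhv⟩ := hh.2 θ₀
    have h₁ := const_mul (hg.1 θ₀) (hK₁ _ _ (hP θ₀) hv)
    have h₂ := hK₂ _ _ hu hh'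
    rw [show k + (l + 1) = k + 1 + l by ring] at h₂
    refine ⟨_, (h₁.add h₂).mono (le_max_right _ _), fun θ => ?_⟩
    rw [hgu θ, hhv θ]
    ring

lemma exists_cos_sub_pow (m k : ℕ) :
    ∃ K, ∀ φ, DivDiff k m K fun θ => Real.cos (θ - φ) ^ k :=
  exists_pow_of_mul (exists_mul m) k

lemma exists_pow {m k : ℕ} {M : ℝ} {g : ℝ → ℝ} (hg : DivDiff k m M g) (n : ℕ) :
    ∃ K, DivDiff (n * k) m K fun θ => g θ ^ n := by
  induction n with
  | zero => exact ⟨1, by simpa using const m (a := 1) (by simp)⟩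
  | succ n ih =>
    obtain ⟨K, hK⟩ := ih
    obtain ⟨L, hL⟩ := exists_mul m (n * k) k K M
    exact ⟨L, by simpa only [pow_succ, Nat.succ_mul] using hL _ _ hK hg⟩

lemma exists_div (m k l : ℕ) (hm : m ≤ k) (M N : ℝ) {η : ℝ} (hη : 0 < η) :
    ∃ K, ∀ g h, DivDiff (k + (l + 1)) m M g → DivDiff (l + 1) m N h → (∀ θ, η ≤ h θ) →
      DivDiff k m K fun θ => g θ / h θ := by
  induction m generalizing k M N with
  | zero =>
    refine ⟨M / η, fun g h hg hh hη' => ?_⟩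
    simp only [DivDiff] at hg ⊢
    intro θ
    rw [abs_div, abs_of_pos (hη.trans_le (hη' θ))]
    exact div_le_div₀ ((abs_nonneg _).trans (hg θ)) (hg θ) hη (hη' θ)
  | succ m ih =>
    obtain ⟨k, rfl⟩ : ∃ k', k = k' + 1 := ⟨k - 1, by omega⟩
    obtain ⟨P, hP⟩ := exists_cos_sub_pow m (k + 1)
    obtain ⟨K₁, hK₁⟩ := exists_mul m (k + 1) l P N
    obtain ⟨K₂, hK₂⟩ := ih k (by omega) (M + M / η * K₁) N
    refine ⟨max (M / η) K₂, fun g h hg hh hη' => ?_⟩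
    have hh' := hh.of_succ
    have hq : ∀ θ, |g θ / h θ| ≤ M / η := fun θ => by
      rw [abs_div, abs_of_pos (hη.trans_le (hη' θ))]
      exact div_le_div₀ ((abs_nonneg _).trans (hg.bound θ)) (hg.bound θ) hη (hη' θ)
    rw [show k + 1 + (l + 1) = (k + (l + 1)) + 1 by ring] at hg
    rw [DivDiff] at hg hh ⊢
    refine ⟨fun θ => (hq θ).trans (le_max_left _ _), fun θ₀ => ?_⟩
    obtain ⟨u, hu, hgu⟩ := hg.2 θ₀
    obtain ⟨v, hv, hhv⟩ := hh.2 θ₀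
    have h₁ := const_mul (a := -(g θ₀ / h θ₀)) (by simpa using hq θ₀) (hK₁ _ _ (hP θ₀) hv)
    rw [show k + 1 + l = k + (l + 1) by ring] at h₁
    refine ⟨_, (hK₂ _ _ (hu.add h₁) hh' hη').mono (le_max_right _ _), fun θ => ?_⟩
    have h0 := (hη.trans_le (hη' θ)).ne'
    have h00 := (hη.trans_le (hη' θ₀)).ne'
    have e : g θ₀ / h θ₀ * Real.cos (θ - θ₀) ^ (k + 1) * h θ = g θ₀ / h θ₀ *
        Real.cos (θ - θ₀) ^ (k + 1) * (h θ₀ * Real.cos (θ - θ₀) ^ (l + 1) +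
          Real.sin (θ - θ₀) * v θ) := by rw [← hhv θ]
    have e2 : g θ₀ / h θ₀ * h θ₀ = g θ₀ := div_mul_cancel₀ _ h00
    rw [div_eq_iff h0, add_mul, e, mul_assoc (Real.sin _), div_mul_cancel₀ _ h0, hgu θ]
    generalize g θ₀ / h θ₀ = r at e2 ⊢
    rw [← e2]
    ring

/-- A solution of a cubic equation whose coefficients have bounded divided differences, and
whose linear coefficient is bounded below, has bounded divided differences. -/
lemma exists_cubic_root {c : ℕ} (hc : 1 ≤ c) {η : ℝ} (hη : 0 < η) {z A B : ℝ → ℝ}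
    (hA : ∀ m, ∃ K, DivDiff (2 * c) m K A) (hB : ∀ m, ∃ K, DivDiff (3 * c) m K B)
    (hηA : ∀ θ, η ≤ A θ) (hz : ∀ θ, z θ ^ 3 + z θ * A θ = B θ) (m : ℕ) (hm : m ≤ c) :
    ∃ K, DivDiff c m K z := by
  obtain ⟨c, rfl⟩ : ∃ c', c = c' + 1 := ⟨c - 1, by omega⟩
  induction m with
  | zero =>
    obtain ⟨K, hK⟩ := hB 0
    refine ⟨K / η, ?_⟩
    simp only [DivDiff] at hK ⊢
    intro θ
    rw [le_div_iff₀ hη]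
    have h1 : z θ * (z θ ^ 2 + A θ) = B θ := by rw [← hz θ]; ring
    have h2 : |z θ| * (z θ ^ 2 + A θ) = |B θ| := by
      rw [← h1, abs_mul, abs_of_pos (a := z θ ^ 2 + A θ)
        (by nlinarith [sq_nonneg (z θ), hηA θ])]
    nlinarith [hK θ, abs_nonneg (z θ), sq_nonneg (z θ), hηA θ,
      mul_nonneg (abs_nonneg (z θ)) (sq_nonneg (z θ)),
      mul_nonneg (abs_nonneg (z θ)) (sub_nonneg.2 (hηA θ))]
  | succ m ih =>
    obtain ⟨K, hK⟩ := ih (by omega)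
    obtain ⟨KA, hKA⟩ := hA (m + 1)
    obtain ⟨KB, hKB⟩ := hB (m + 1)
    obtain ⟨P, hP⟩ := exists_cos_sub_pow m (c + 1)
    obtain ⟨L₁, hL₁⟩ := exists_mul m (c + 1) (2 * c + 1) P KA
    obtain ⟨L₂, hL₂⟩ := exists_mul m (c + 1) (c + 1) K K
    obtain ⟨L₃, hL₃⟩ := exists_mul m (c + 1) (c + 1) K (K * P)
    obtain ⟨L₄, hL₄⟩ := exists_mul m (c + 1) (c + 1) (K * P) (K * P)
    obtain ⟨L, hL⟩ := exists_div m c (2 * c + 1) (by omega) (KB + K * L₁)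
      (((L₂ + L₃) + L₄) + KA) hη
    refine ⟨max K L, ?_⟩
    have hA' := hKA.of_succ
    rw [show 2 * (c + 1) = (2 * c + 1) + 1 by ring] at hKA hA'
    rw [show 3 * (c + 1) = (3 * c + 2) + 1 by ring] at hKB
    have hz0 := hK.bound
    rw [DivDiff] at hKA hKB ⊢
    refine ⟨fun θ => (hz0 θ).trans (le_max_left _ _), fun θ₀ => ?_⟩
    obtain ⟨u, hu, hAu⟩ := hKA.2 θ₀
    obtain ⟨v, hv, hBv⟩ := hKB.2 θ₀
    have hw := const_mul (hz0 θ₀) (hP θ₀)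
    have h₁ := const_mul (a := -z θ₀) (by simpa using hz0 θ₀) (hL₁ _ _ (hP θ₀) hu)
    rw [show c + 1 + (2 * c + 1) = c + (2 * c + 1 + 1) by ring] at h₁
    rw [show 3 * c + 2 = c + (2 * c + 1 + 1) by ring] at hv
    have hD := ((hL₂ _ _ hK hK).add (hL₃ _ _ hK hw)).add (hL₄ _ _ hw hw)
    rw [show c + 1 + (c + 1) = 2 * c + 1 + 1 by ring] at hD
    have hden : ∀ θ, η ≤ z θ * z θ + z θ * (z θ₀ * Real.cos (θ - θ₀) ^ (c + 1)) +
        z θ₀ * Real.cos (θ - θ₀) ^ (c + 1) * (z θ₀ * Real.cos (θ - θ₀) ^ (c + 1)) + A θ := by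
      intro θ
      nlinarith [hηA θ, sq_nonneg (z θ + z θ₀ * Real.cos (θ - θ₀) ^ (c + 1)),
        sq_nonneg (z θ), sq_nonneg (z θ₀ * Real.cos (θ - θ₀) ^ (c + 1))]
    refine ⟨_, (hL _ _ (hv.add h₁) (hD.add hA') hden).mono (le_max_right _ _), fun θ => ?_⟩
    have h0 := (hη.trans_le (hden θ)).ne'
    rw [← sub_eq_iff_eq_add', ← mul_div_assoc, eq_div_iff h0]
    have e1 := hz θ
    have e0 := hz θ₀
    have eA := hAu θ
    have eB := hBv θ
    generalize Real.cos (θ - θ₀) = C at *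
    generalize Real.sin (θ - θ₀) = S at *
    have e3 : (C ^ (c + 1)) ^ 3 = C ^ (3 * c + 2 + 1) := by rw [← pow_mul]; congr 1; ring
    have e2 : C ^ (c + 1) * C ^ (2 * c + 1 + 1) = C ^ (3 * c + 2 + 1) := by
      rw [← pow_add]; congr 1; ring
    generalize C ^ (c + 1) = x at *
    generalize C ^ (2 * c + 1 + 1) = y at *
    generalize C ^ (3 * c + 2 + 1) = w at *
    linear_combination e1 + eB - w * e0 - z θ₀ * x * eA - z θ₀ ^ 3 * e3 - z θ₀ * A θ₀ * e2

end DivDiff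

/-- `F` is a binary form of degree `k` in `cos θ` and `sin θ` with coefficients bounded by `K`. -/
def IsTrigForm (k : ℕ) (K : ℝ) (F : ℝ → ℝ) : Prop :=
  ∃ φ : ℕ → ℝ, (∀ i, |φ i| ≤ K) ∧
    ∀ θ, F θ = ∑ i ∈ Finset.range (k + 1), φ i * (Real.cos θ ^ (k - i) * Real.sin θ ^ i)

namespace IsTrigForm

lemma add {k : ℕ} {K L : ℝ} {F G : ℝ → ℝ} (hF : IsTrigForm k K F) (hG : IsTrigForm k L G) :
    IsTrigForm k (K + L) (fun θ => F θ + G θ) := by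
  obtain ⟨φ, hφ, hF⟩ := hF
  obtain ⟨χ, hχ, hG⟩ := hG
  refine ⟨fun i => φ i + χ i, fun i => (abs_add_le _ _).trans (add_le_add (hφ i) (hχ i)),
    fun θ => ?_⟩
  beta_reduce
  rw [hF, hG, ← Finset.sum_add_distrib]
  exact Finset.sum_congr rfl fun i _ => by ring

lemma const_mul {k : ℕ} {K M a : ℝ} (ha : |a| ≤ M) {F : ℝ → ℝ} (hF : IsTrigForm k K F) :
    IsTrigForm k (M * K) (fun θ => a * F θ) := by
  obtain ⟨φ, hφ, hF⟩ := hF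
  refine ⟨fun i => a * φ i, fun i => ?_, fun θ => ?_⟩
  · rw [abs_mul]
    exact mul_le_mul ha (hφ i) (abs_nonneg _) ((abs_nonneg _).trans ha)
  · beta_reduce
    rw [hF, Finset.mul_sum]
    exact Finset.sum_congr rfl fun i _ => by ring

lemma linear_mul {k : ℕ} {K α β : ℝ} (hα : |α| ≤ 1) (hβ : |β| ≤ 1) {F : ℝ → ℝ}
    (hF : IsTrigForm k K F) :
    IsTrigForm (k + 1) (K + K) (fun θ => (α * Real.cos θ + β * Real.sin θ) * F θ) := by
  obtain ⟨φ, hφ, hF⟩ := hF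
  have hK : 0 ≤ K := (abs_nonneg _).trans (hφ 0)
  refine ⟨fun i => α * (if i ≤ k then φ i else 0) + β * (if i = 0 then 0 else φ (i - 1)),
    fun i => ?_, fun θ => ?_⟩
  · refine (abs_add_le _ _).trans (add_le_add ?_ ?_) <;> rw [abs_mul, ← one_mul K]
    · refine mul_le_mul hα ?_ (abs_nonneg _) zero_le_one
      split_ifs <;> simp [hφ, hK]
    · refine mul_le_mul hβ ?_ (abs_nonneg _) zero_le_one
      split_ifs <;> simp [hφ, hK]
  · beta_reduce
    rw [hF]
    simp only [add_mul, Finset.sum_add_distrib]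
    congr 1
    · rw [Finset.sum_range_succ _ (k + 1), if_neg (by omega), Finset.mul_sum]
      simp only [mul_zero, zero_mul, add_zero]
      refine Finset.sum_congr rfl fun i hi => ?_
      rw [Finset.mem_range] at hi
      rw [if_pos (by omega), show k + 1 - i = (k - i) + 1 by omega]
      ring
    · rw [Finset.sum_range_succ' _ (k + 1), if_pos rfl, Finset.mul_sum]
      simp only [mul_zero, zero_mul, add_zero]
      refine Finset.sum_congr rfl fun i _ => ?_
      rw [if_neg (by omega), Nat.add_sub_cancel, Nat.add_sub_add_right]
      ring

lemma cos_sub_pow (k : ℕ) (φ : ℝ) : IsTrigForm k (2 ^ k) (fun θ => Real.cos (θ - φ) ^ k) := by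
  induction k with
  | zero => exact ⟨fun _ => 1, by simp, by simp⟩
  | succ k ih =>
    have := linear_mul (Real.abs_cos_le_one φ) (Real.abs_sin_le_one φ) ih
    rw [pow_succ (2 : ℝ), mul_two]
    convert this using 2 with θ
    rw [pow_succ, Real.cos_sub]
    ring

end IsTrigForm

/-- Interpolation of a function with bounded divided differences at arbitrary nodes. -/
lemma DivDiff.exists_interpolation (k : ℕ) (M : ℝ) : ∃ K, ∀ g, DivDiff k k M g → ∀ τ : ℕ → ℝ,
    ∃ F, IsTrigForm k K F ∧ ∀ j ≤ k, g (τ j) = F (τ j) := by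
  induction k with
  | zero =>
    refine ⟨M, fun g hg τ => ⟨fun _ => g (τ 0), ⟨fun _ => g (τ 0), fun _ => hg.bound _, by simp⟩,
      fun j hj => by rw [Nat.le_zero.1 hj]⟩⟩
  | succ k ih =>
    obtain ⟨K, hK⟩ := ih
    refine ⟨M * 2 ^ (k + 1) + (K + K), fun g hg τ => ?_⟩
    have hb := hg.bound
    rw [DivDiff] at hg
    obtain ⟨h, hh, hgh⟩ := hg.2 (τ 0)
    obtain ⟨H, hH, hHτ⟩ := hK h hh fun j => τ (j + 1)
    refine ⟨_, ((IsTrigForm.cos_sub_pow (k + 1) (τ 0)).const_mul (hb (τ 0))).add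
      (hH.linear_mul (α := -Real.sin (τ 0)) (β := Real.cos (τ 0))
        (by simpa using Real.abs_sin_le_one _) (Real.abs_cos_le_one _)), fun j hj => ?_⟩
    have hs : -Real.sin (τ 0) * Real.cos (τ j) + Real.cos (τ 0) * Real.sin (τ j) =
        Real.sin (τ j - τ 0) := by rw [Real.sin_sub]; ring
    rw [hs, hgh]
    rcases j with _ | j
    · simp
    · rw [hHτ j (by omega)]

lemma exists_cubic_eq {a : ℝ} (ha : 0 ≤ a) (b : ℝ) : ∃ z : ℝ, z ^ 3 + z * a = b := by
  have hcont : Continuous fun z : ℝ => z ^ 3 + z * a := by fun_prop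
  have hmem : b ∈ Set.Icc ((-(|b| + 1)) ^ 3 + (-(|b| + 1)) * a)
      ((|b| + 1) ^ 3 + (|b| + 1) * a) := by
    have h0 := abs_nonneg b
    have h1 : |b| ≤ (|b| + 1) ^ 3 := by nlinarith [pow_nonneg h0 2, pow_nonneg h0 3]
    have h2 : 0 ≤ (|b| + 1) * a := by positivity
    constructor
    · nlinarith [neg_abs_le b]
    · nlinarith [le_abs_self b]
  obtain ⟨z, -, hz⟩ := intermediate_value_Icc (by linarith [abs_nonneg b]) hcont.continuousOn hmem
  exact ⟨z, hz⟩

lemma cubic_injective {a : ℝ} (ha : 0 ≤ a) {z w : ℝ} (h : z ^ 3 + z * a = w ^ 3 + w * a) :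
    z = w := by
  have h1 : (z - w) * (z ^ 2 + z * w + w ^ 2 + a) = 0 := by linear_combination h
  rcases mul_eq_zero.1 h1 with h2 | h2
  · linarith
  · have h3 : z ^ 2 + w ^ 2 = 0 := by nlinarith [sq_nonneg (z + w), sq_nonneg z, sq_nonneg w]
    have hz : z = 0 := by nlinarith [sq_nonneg z, sq_nonneg w]
    have hw : w = 0 := by nlinarith [sq_nonneg z, sq_nonneg w]
    rw [hz, hw]

/-- The cubic function over the rational normal curve can be interpolated at any `c + 1` nodes by
a form of degree `c` whose coefficients are bounded independently of the nodes. -/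
lemma exists_interpolation_cubic {c : ℕ} (hc : 1 ≤ c) : ∃ (z : ℝ → ℝ) (K : ℝ),
    (∀ θ, z θ ^ 3 + z θ * ((Real.cos θ ^ c) ^ 2 + (Real.sin θ ^ c) ^ 2) =
      Real.cos θ ^ c * ((Real.cos θ ^ c) ^ 2 + (Real.sin θ ^ c) ^ 2)) ∧
    ∀ τ : ℕ → ℝ, ∃ F, IsTrigForm c K F ∧ ∀ j ≤ c, z (τ j) = F (τ j) := by
  have hpos : ∀ θ, 0 ≤ (Real.cos θ ^ c) ^ 2 + (Real.sin θ ^ c) ^ 2 := fun θ => by positivity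
  choose z hz using fun θ => exists_cubic_eq (hpos θ)
    (Real.cos θ ^ c * ((Real.cos θ ^ c) ^ 2 + (Real.sin θ ^ c) ^ 2))
  have hcos : ∀ m n, ∃ K, DivDiff n m K fun θ => Real.cos θ ^ n := fun m n => by
    simpa using (DivDiff.cos_sub m 0).exists_pow n
  have hsin : ∀ m n, ∃ K, DivDiff n m K fun θ => Real.sin θ ^ n := fun m n => by
    simpa [Real.cos_sub_pi_div_two] using (DivDiff.cos_sub m (Real.pi / 2)).exists_pow n
  have hA : ∀ m, ∃ K, DivDiff (2 * c) m K
      fun θ => (Real.cos θ ^ c) ^ 2 + (Real.sin θ ^ c) ^ 2 := fun m => by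
    obtain ⟨K, hK⟩ := hcos m c
    obtain ⟨K', hK'⟩ := hK.exists_pow 2
    obtain ⟨L, hL⟩ := hsin m c
    obtain ⟨L', hL'⟩ := hL.exists_pow 2
    exact ⟨_, hK'.add hL'⟩
  have hB : ∀ m, ∃ K, DivDiff (3 * c) m K
      fun θ => Real.cos θ ^ c * ((Real.cos θ ^ c) ^ 2 + (Real.sin θ ^ c) ^ 2) := fun m => by
    obtain ⟨K, hK⟩ := hcos m c
    obtain ⟨L, hL⟩ := hA m
    obtain ⟨N, hN⟩ := DivDiff.exists_mul m c (2 * c) K L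
    exact ⟨N, by simpa only [show 3 * c = c + 2 * c by ring] using hN _ _ hK hL⟩
  have hη : ∀ θ, (1 / 2 : ℝ) ^ c ≤ (Real.cos θ ^ c) ^ 2 + (Real.sin θ ^ c) ^ 2 := fun θ => by
    rw [← pow_mul, ← pow_mul, mul_comm, pow_mul, pow_mul]
    have h1 := Real.sin_sq_add_cos_sq θ
    rcases le_total (1 / 2) (Real.cos θ ^ 2) with h | h
    · exact (pow_le_pow_left₀ (by norm_num) h c).trans (le_add_of_nonneg_right (by positivity))
    · have h' : 1 / 2 ≤ Real.sin θ ^ 2 := by linarith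
      exact (pow_le_pow_left₀ (by norm_num) h' c).trans (le_add_of_nonneg_left (by positivity))
  obtain ⟨M, hM⟩ := DivDiff.exists_cubic_root hc (by positivity) hA hB hη hz c le_rfl
  obtain ⟨K, hK⟩ := DivDiff.exists_interpolation c M
  exact ⟨z, K, hz, hK z hM⟩

lemma AnalyticAt.of_cubic_eq {z A B : ℝ → ℝ} {x : ℝ} (hA : AnalyticAt ℝ A x)
    (hB : AnalyticAt ℝ B x) (hpos : ∀ θ, 0 < A θ) (hz : ∀ θ, z θ ^ 3 + z θ * A θ = B θ) :
    AnalyticAt ℝ z x := by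
  have hD : ∀ θ, 0 < B θ ^ 2 / 4 + A θ ^ 3 / 27 := fun θ => by
    have := hpos θ
    positivity
  have hr : ∀ θ, Real.exp (Real.log (B θ ^ 2 / 4 + A θ ^ 3 / 27) / 2) ^ 2 =
      B θ ^ 2 / 4 + A θ ^ 3 / 27 := fun θ => by
    rw [← Real.exp_nat_mul, Nat.cast_ofNat, mul_div_cancel₀ _ two_ne_zero, Real.exp_log (hD θ)]
  set r : ℝ → ℝ := fun θ => Real.exp (Real.log (B θ ^ 2 / 4 + A θ ^ 3 / 27) / 2) with hrdef
  have hw : ∀ θ, 0 < B θ / 2 + r θ := fun θ => by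
    have h1 : 0 < r θ := Real.exp_pos _
    have h2 : (B θ / 2) ^ 2 < r θ ^ 2 := by
      rw [hr]
      have := pow_pos (hpos θ) 3
      nlinarith
    have := abs_lt.1 (abs_lt_of_sq_lt_sq h2 h1.le)
    linarith [this.1]
  have hu : ∀ θ, Real.exp (Real.log (B θ / 2 + r θ) / 3) ^ 3 = B θ / 2 + r θ := fun θ => by
    rw [← Real.exp_nat_mul, Nat.cast_ofNat, mul_div_cancel₀ _ three_ne_zero, Real.exp_log (hw θ)]
  set u : ℝ → ℝ := fun θ => Real.exp (Real.log (B θ / 2 + r θ) / 3) with hudef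
  have hu0 : ∀ θ, u θ ≠ 0 := fun θ => Real.exp_ne_zero _
  have hra : AnalyticAt ℝ r x := by
    have : AnalyticAt ℝ (fun θ => B θ ^ 2 / 4 + A θ ^ 3 / 27) x := by fun_prop
    exact ((this.log (hD x)).div analyticAt_const two_ne_zero).rexp
  have hua : AnalyticAt ℝ u x := by
    have : AnalyticAt ℝ (fun θ => B θ / 2 + r θ) x := by fun_prop
    exact ((this.log (hw x)).div analyticAt_const three_ne_zero).rexp
  have hza : z = fun θ => u θ - A θ / (3 * u θ) := by
    funext θ
    refine cubic_injective (hpos θ).le ?_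
    rw [hz]
    have h3 := hu θ
    have h2 := hr θ
    have h0 := hu0 θ
    change u θ ^ 3 = _ at h3
    change r θ ^ 2 = _ at h2
    generalize u θ = u at *
    generalize r θ = r at *
    field_simp
    linear_combination (-27 * u ^ 3 - 27 * r + 27 * B θ / 2) * h3 - 27 * h2
  rw [hza]
  exact hua.sub (hA.div (by fun_prop) (mul_ne_zero three_ne_zero (hu0 x)))

/-- The point with rational normal curve coordinates `l * s ^ (c - j) * t ^ j` for `j ≤ c`,
followed by `z` and by free coordinates `y`. -/
def conePoint {n : ℕ} (c : ℕ) (l s t z : ℝ) (y : Fin n → ℝ) : Fin n → ℝ := fun j =>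
  if j.1 ≤ c then l * (s ^ (c - j.1) * t ^ j.1) else if j.1 = c + 1 then z else y j

/-- The cone of points `conePoint c l s t z y` for which `z` is the solution of the cubic equation
`z³ + z (x₀² + x_c²) = x₀ (x₀² + x_c²)`. -/
def cubicCone (c n : ℕ) : Set (Fin n → ℝ) :=
  {x | ∃ l s t z y, z ^ 3 + z * ((l * s ^ c) ^ 2 + (l * t ^ c) ^ 2) =
    l * s ^ c * ((l * s ^ c) ^ 2 + (l * t ^ c) ^ 2) ∧ x = conePoint c l s t z y}

/-- `z` is the solution of the cubic equation defining `cubicCone c n` over the unit circle. -/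
def IsCircleRoot (c : ℕ) (z : ℝ → ℝ) : Prop :=
  ∀ θ, z θ ^ 3 + z θ * ((Real.cos θ ^ c) ^ 2 + (Real.sin θ ^ c) ^ 2) =
    Real.cos θ ^ c * ((Real.cos θ ^ c) ^ 2 + (Real.sin θ ^ c) ^ 2)

lemma cos_pow_sq_add_sin_pow_sq_pos (c : ℕ) (θ : ℝ) :
    0 < (Real.cos θ ^ c) ^ 2 + (Real.sin θ ^ c) ^ 2 := by
  by_cases h : Real.cos θ = 0
  · have h1 : Real.sin θ ≠ 0 := fun h1 => by simpa [h, h1] using Real.sin_sq_add_cos_sq θ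
    positivity
  · positivity

lemma exists_isCircleRoot (c : ℕ) : ∃ z, IsCircleRoot c z := by
  choose z hz using fun θ => exists_cubic_eq (cos_pow_sq_add_sin_pow_sq_pos c θ).le
    (Real.cos θ ^ c * ((Real.cos θ ^ c) ^ 2 + (Real.sin θ ^ c) ^ 2))
  exact ⟨z, hz⟩

namespace IsCircleRoot

variable {c n : ℕ} {z : ℝ → ℝ}

lemma analyticAt (hz : IsCircleRoot c z) (θ : ℝ) : AnalyticAt ℝ z θ := by
  refine AnalyticAt.of_cubic_eq ?_ ?_ (cos_pow_sq_add_sin_pow_sq_pos c) hz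
  · exact ((Real.analyticAt_cos.pow c).pow 2).add ((Real.analyticAt_sin.pow c).pow 2)
  · exact (Real.analyticAt_cos.pow c).mul
      (((Real.analyticAt_cos.pow c).pow 2).add ((Real.analyticAt_sin.pow c).pow 2))

lemma mem_cubicCone (hz : IsCircleRoot c z) (l θ : ℝ) (y : Fin n → ℝ) :
    conePoint c l (Real.cos θ) (Real.sin θ) (l * z θ) y ∈ cubicCone c n :=
  ⟨_, _, _, _, _, by linear_combination l ^ 3 * hz θ, rfl⟩

lemma mem_cubicCone_iff (hz : IsCircleRoot c z) {x : Fin n → ℝ} : x ∈ cubicCone c n ↔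
    ∃ l θ y, x = conePoint c l (Real.cos θ) (Real.sin θ) (l * z θ) y := by
  refine ⟨?_, fun ⟨l, θ, y, hx⟩ => hx ▸ hz.mem_cubicCone l θ y⟩
  rintro ⟨l, s, t, w, y, hw, rfl⟩
  obtain ⟨ρ, θ, rfl, rfl⟩ : ∃ ρ θ : ℝ, s = ρ * Real.cos θ ∧ t = ρ * Real.sin θ :=
    ⟨‖(⟨s, t⟩ : ℂ)‖, Complex.arg ⟨s, t⟩, (Complex.norm_mul_cos_arg ⟨s, t⟩).symm,
      (Complex.norm_mul_sin_arg ⟨s, t⟩).symm⟩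
  refine ⟨l * ρ ^ c, θ, y, ?_⟩
  have hw' : w = l * ρ ^ c * z θ := by
    refine cubic_injective (by positivity) (hw.trans ?_)
    linear_combination -(l * ρ ^ c) ^ 3 * hz θ
  funext j
  simp only [conePoint]
  split_ifs with h1 h2
  · rw [mul_pow, mul_pow]
    rw [show ρ ^ c = ρ ^ (c - j.1) * ρ ^ j.1 by rw [← pow_add]; congr 1; omega]
    ring
  · exact hw'
  · rfl

end IsCircleRoot

lemma isPrime_vanishingIdeal_cubicCone (c n : ℕ) :
    (vanishingIdeal ℝ (cubicCone c n)).IsPrime := by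
  obtain ⟨z, hz⟩ := exists_isCircleRoot c
  refine ⟨fun h => ?_, fun {f g} hfg => ?_⟩
  · have h1 := (Ideal.eq_top_iff_one _).1 h _ (hz.mem_cubicCone 0 0 0)
    simp at h1
  · by_contra! h
    simp only [mem_vanishingIdeal_iff, not_forall] at h
    obtain ⟨⟨x, hx, hf⟩, ⟨x', hx', hg⟩⟩ := h
    obtain ⟨l, θ, y, rfl⟩ := hz.mem_cubicCone_iff.1 hx
    obtain ⟨l', θ', y', rfl⟩ := hz.mem_cubicCone_iff.1 hx'
    set γ : ℝ → Fin n → ℝ := fun τ => conePoint c (l + τ * (l' - l))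
      (Real.cos (θ + τ * (θ' - θ))) (Real.sin (θ + τ * (θ' - θ)))
      ((l + τ * (l' - l)) * z (θ + τ * (θ' - θ))) (fun i => y i + τ * (y' i - y i)) with hγ
    have hγa : ∀ i, AnalyticOnNhd ℝ (γ · i) Set.univ := fun i τ _ => by
      have hlin : ∀ a b : ℝ, AnalyticAt ℝ (fun τ => a + τ * b) τ := fun a b => by fun_prop
      simp only [hγ, conePoint]
      split_ifs
      · exact (hlin _ _).mul (((Real.analyticAt_cos.comp (hlin _ _)).pow _).mul
          ((Real.analyticAt_sin.comp (hlin _ _)).pow _))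
      · exact (hlin _ _).mul ((hz.analyticAt _).comp (hlin _ _))
      · exact hlin _ _
    have hmul : ∀ τ ∈ Set.univ, aeval (γ τ) f * aeval (γ τ) g = 0 := fun τ _ => by
      rw [← map_mul]
      exact hfg _ (hz.mem_cubicCone _ _ _)
    rcases AnalyticOnNhd.eq_zero_or_eq_zero_of_mul_eq_zero
      (AnalyticOnNhd.aeval_mvPolynomial hγa f) (AnalyticOnNhd.aeval_mvPolynomial hγa g)
      hmul isPreconnected_univ with h0 | h0
    · refine hf ?_
      simpa [hγ] using h0 0 trivial
    · refine hg ?_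
      simpa [hγ] using h0 1 trivial

lemma smul_mem_cubicCone {c n : ℕ} {x : Fin n → ℝ} (hx : x ∈ cubicCone c n) (a : ℝ) :
    a • x ∈ cubicCone c n := by
  obtain ⟨l, s, t, z, y, hz, rfl⟩ := hx
  refine ⟨a * l, s, t, a * z, a • y, by linear_combination a ^ 3 * hz, ?_⟩
  funext j
  simp only [conePoint, Pi.smul_apply, smul_eq_mul]
  split_ifs <;> ring

lemma aeval_smul_of_isHomogeneous {σ : Type*} {f : MvPolynomial σ ℝ} {e : ℕ}
    (hf : f.IsHomogeneous e) (a : ℝ) (x : σ → ℝ) : aeval (a • x) f = a ^ e * aeval x f := by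
  rw [aeval_def, aeval_def, eval₂_eq, eval₂_eq, Finset.mul_sum]
  refine Finset.sum_congr rfl fun m hm => ?_
  simp only [Pi.smul_apply, smul_eq_mul, mul_pow, Finset.prod_mul_distrib,
    Finset.prod_pow_eq_pow_sum]
  rw [show ∑ i ∈ m.support, m i = e from (hf.degree_eq_sum_deg_support hm).symm]
  ring

/-- The vanishing ideal of a cone is homogeneous. -/
lemma homogeneousComponent_mem_vanishingIdeal {σ : Type*} {S : Set (σ → ℝ)}
    (hS : ∀ x ∈ S, ∀ a : ℝ, a • x ∈ S) {f : MvPolynomial σ ℝ} (hf : f ∈ vanishingIdeal ℝ S)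
    (e : ℕ) : homogeneousComponent e f ∈ vanishingIdeal ℝ S := by
  intro x hx
  set P : Polynomial ℝ := ∑ i ∈ Finset.range (f.totalDegree + 1),
    Polynomial.monomial i (aeval x (homogeneousComponent i f)) with hP
  have hP0 : P = 0 := by
    refine Polynomial.funext fun a => ?_
    have h1 := hf _ (hS x hx a)
    rw [← sum_homogeneousComponent f, map_sum] at h1
    rw [hP, Polynomial.eval_finsetSum, Polynomial.eval_zero, ← h1]
    refine Finset.sum_congr rfl fun i _ => ?_
    rw [Polynomial.eval_monomial,
      aeval_smul_of_isHomogeneous (homogeneousComponent_isHomogeneous i f),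
      mul_comm]
  by_cases he : e ∈ Finset.range (f.totalDegree + 1)
  · have := congrArg (fun p => Polynomial.coeff p e) hP0
    simpa [hP, Polynomial.coeff_monomial, he] using this
  · rw [homogeneousComponent_eq_zero _ _ (by simpa using he), map_zero]

lemma not_exists_polynomial_cubic {c : ℕ} (hc : 1 ≤ c) (g : Polynomial ℝ)
    (hg : ∀ t : ℝ, g.eval t ^ 3 + g.eval t * (1 + (t ^ c) ^ 2) = 1 + (t ^ c) ^ 2) : False := by
  have hg' : g ^ 3 = (1 - g) * (1 + (Polynomial.X ^ c) ^ 2) := Polynomial.funext fun t => by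
    have := hg t
    simp only [Polynomial.eval_pow, Polynomial.eval_mul, Polynomial.eval_sub, Polynomial.eval_one,
      Polynomial.eval_add, Polynomial.eval_X]
    linear_combination this
  have hcop : IsCoprime (1 - g) (g ^ 3) := IsCoprime.pow_right ⟨1, 1, by ring⟩
  have hunit : IsUnit (1 - g) := hcop.isUnit_of_dvd' dvd_rfl ⟨_, hg'⟩
  obtain ⟨r, -, hr⟩ := Polynomial.isUnit_iff.1 hunit
  have hgr : ∀ t, g.eval t = 1 - r := fun t => by
    rw [show g = 1 - Polynomial.C r by rw [hr]; ring]
    simp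
  have h0 := hg 0
  have h1 := hg 1
  rw [hgr, zero_pow (by omega)] at h0
  rw [hgr, one_pow] at h1
  have hr0 : r = 0 := by linear_combination h0 - h1
  rw [hr0] at h0
  norm_num at h0

/-- The cone `cubicCone c n` is not contained in a hyperplane. -/
lemma eq_zero_of_forall_mem_cubicCone {c n : ℕ} (hc : 1 ≤ c) (hn : c + 1 < n) {a : Fin n → ℝ}
    (ha : ∀ x ∈ cubicCone c n, ∑ j, a j * x j = 0) : a = 0 := by
  have hy : ∀ j : Fin n, c + 1 < j.1 → a j = 0 := fun j hj => by
    have h1 := ha (conePoint c 0 0 0 0 (Pi.single j 1)) ⟨0, 0, 0, 0, _, by ring, rfl⟩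
    rw [Finset.sum_eq_single j] at h1
    · simpa [conePoint, show ¬ j.1 ≤ c by omega, show j.1 ≠ c + 1 by omega] using h1
    · intro i _ hij
      simp [conePoint, Pi.single_eq_of_ne hij]
    · simp
  set P : Polynomial ℝ := ∑ j : Fin n, if j.1 ≤ c then Polynomial.monomial j.1 (a j) else 0
    with hP
  have hPc : ∀ j : Fin n, j.1 ≤ c → P.coeff j = a j := fun j hj => by
    rw [hP, Polynomial.finsetSum_coeff, Finset.sum_eq_single j]
    · simp [hj]
    · intro i _ hij
      split_ifs
      · rw [Polynomial.coeff_monomial, if_neg (fun h => hij (Fin.ext h))]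
      · simp
    · simp
  have hPz : ∀ t z : ℝ, z ^ 3 + z * (1 + (t ^ c) ^ 2) = 1 + (t ^ c) ^ 2 →
      P.eval t + a ⟨c + 1, hn⟩ * z = 0 := fun t z hz => by
    rw [← ha (conePoint c 1 1 t z 0) ⟨1, 1, t, z, 0, by linear_combination hz, rfl⟩, hP,
      Polynomial.eval_finsetSum, show a ⟨c + 1, hn⟩ * z = ∑ j : Fin n,
        if j = ⟨c + 1, hn⟩ then a j * z else 0 by simp, ← Finset.sum_add_distrib]
    refine Finset.sum_congr rfl fun j _ => ?_
    simp only [conePoint, Fin.ext_iff]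
    split_ifs with h1 h2 <;> first | omega | simp
  have haz : a ⟨c + 1, hn⟩ = 0 := by
    by_contra h0
    refine not_exists_polynomial_cubic hc (Polynomial.C (-(a ⟨c + 1, hn⟩)⁻¹) * P) fun t => ?_
    obtain ⟨z, hz⟩ := exists_cubic_eq (a := 1 + (t ^ c) ^ 2) (by positivity) (1 + (t ^ c) ^ 2)
    have h1 : z = (Polynomial.C (-(a ⟨c + 1, hn⟩)⁻¹) * P).eval t := by
      rw [Polynomial.eval_mul, Polynomial.eval_C, eq_neg_of_add_eq_zero_left (hPz t z hz)]
      field_simp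
    rw [← h1, hz]
  have hP0 : P = 0 := Polynomial.funext fun t => by
    obtain ⟨z, hz⟩ := exists_cubic_eq (a := 1 + (t ^ c) ^ 2) (by positivity) (1 + (t ^ c) ^ 2)
    simpa [haz] using hPz t z hz
  funext j
  rcases lt_trichotomy j.1 (c + 1) with h | h | h
  · rw [← hPc j (by omega), hP0]
    simp
  · rw [show j = ⟨c + 1, hn⟩ from Fin.ext h, haz]
    rfl
  · exact hy j h

/-- A quadric containing the rational normal curve. -/
lemma X_mul_X_sub_mem_vanishingIdeal {c n : ℕ} {i j k l : Fin n} (hi : i.1 ≤ c) (hj : j.1 ≤ c)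
    (hk : k.1 ≤ c) (hl : l.1 ≤ c) (h : i.1 + j.1 = k.1 + l.1) :
    X i * X j - X k * X l ∈ vanishingIdeal ℝ (cubicCone c n) := by
  rintro x ⟨m, s, t, z, y, -, rfl⟩
  simp only [map_sub, map_mul, aeval_X, conePoint, hi, hj, hk, hl, if_true]
  have h1 : s ^ (c - i.1) * s ^ (c - j.1) = s ^ (c - k.1) * s ^ (c - l.1) := by
    rw [← pow_add, ← pow_add]
    congr 1
    omega
  have h2 : t ^ i.1 * t ^ j.1 = t ^ k.1 * t ^ l.1 := by rw [← pow_add, ← pow_add, h]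
  linear_combination m ^ 2 * t ^ i.1 * t ^ j.1 * h1 + m ^ 2 * s ^ (c - k.1) * s ^ (c - l.1) * h2

/-- The cubic equation of `cubicCone c n`. -/
lemma cubic_mem_vanishingIdeal {c n : ℕ} {i j k : Fin n} (hi : i.1 = 0) (hj : j.1 = c)
    (hk : k.1 = c + 1) :
    (X k ^ 3 + X k * (X i ^ 2 + X j ^ 2) - X i * (X i ^ 2 + X j ^ 2) : MvPolynomial (Fin n) ℝ) ∈
      vanishingIdeal ℝ (cubicCone c n) := by
  rintro x ⟨m, s, t, z, y, h, rfl⟩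
  simp only [map_sub, map_add, map_mul, map_pow, aeval_X, conePoint, hi, hj, hk, le_refl, if_true,
    Nat.zero_le, Nat.sub_self, Nat.sub_zero, pow_zero, mul_one, one_mul,
    if_neg (Nat.not_succ_le_self c)]
  linear_combination h

lemma mem_cubicCone_of_forall_vanishingIdeal {c n : ℕ} (hc : 1 ≤ c) (hn : c + 1 < n)
    {x : Fin n → ℝ} (hx : ∀ f ∈ vanishingIdeal ℝ (cubicCone c n), aeval x f = 0) :
    x ∈ cubicCone c n := by
  have hq : ∀ {i j k l : ℕ} (hi : i ≤ c) (hj : j ≤ c) (hk : k ≤ c) (hl : l ≤ c)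
      (_ : i + j = k + l), x ⟨i, by omega⟩ * x ⟨j, by omega⟩ = x ⟨k, by omega⟩ * x ⟨l, by omega⟩ :=
    fun {i j k l} hi hj hk hl h => by
      have := hx _ (X_mul_X_sub_mem_vanishingIdeal (i := ⟨i, by omega⟩) (j := ⟨j, by omega⟩)
        (k := ⟨k, by omega⟩) (l := ⟨l, by omega⟩) hi hj hk hl h)
      simpa [sub_eq_zero] using this
  have hcub := hx _ (cubic_mem_vanishingIdeal (i := ⟨0, by omega⟩) (j := ⟨c, by omega⟩)
    (k := ⟨c + 1, by omega⟩) rfl rfl rfl)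
  simp only [map_sub, map_add, map_mul, map_pow, aeval_X] at hcub
  obtain ⟨l, s, t, hl⟩ : ∃ l s t : ℝ, ∀ i (hi : i ≤ c),
      x ⟨i, by omega⟩ = l * (s ^ (c - i) * t ^ i) := by
    by_cases h0 : x ⟨0, by omega⟩ = 0
    · refine ⟨x ⟨c, by omega⟩, 0, 1, fun i hi => ?_⟩
      rcases hi.lt_or_eq with hi | rfl
      · rw [zero_pow (by omega), zero_mul, mul_zero]
        induction i with
        | zero => exact h0
        | succ i ih =>
          have h1 := hq (i := i + 1) (j := i + 1) (k := i) (l := i + 2) (by omega) (by omega)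
            (by omega) (by omega) (by omega)
          rw [ih (by omega) (by omega), zero_mul] at h1
          exact mul_self_eq_zero.1 h1
      · simp
    · refine ⟨x ⟨0, by omega⟩, 1, x ⟨1, by omega⟩ / x ⟨0, by omega⟩, fun i hi => ?_⟩
      rw [one_pow, one_mul]
      induction i with
      | zero => simp
      | succ i ih =>
        have h1 := hq (i := 0) (j := i + 1) (k := 1) (l := i) (by omega) (by omega)
            (by omega) (by omega) (by omega)
        rw [ih (by omega)] at h1
        refine mul_left_cancel₀ h0 ?_
        rw [h1, pow_succ]
        field_simp
  refine ⟨l, s, t, x ⟨c + 1, by omega⟩, x, ?_, ?_⟩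
  · have h1 := hl 0 (by omega)
    have h2 := hl c le_rfl
    simp only [Nat.sub_zero, pow_zero, mul_one, Nat.sub_self, one_mul] at h1 h2
    rw [h1, h2] at hcub
    linear_combination hcub
  · funext j
    simp only [conePoint]
    split_ifs with h1 h2
    · exact hl j.1 h1
    · exact congrArg x (Fin.ext h2)
    · rfl

lemma exists_forall_le_of_sum_mem_cubicCone {c n : ℕ} (hc : 1 ≤ c) (hn : c + 1 < n) :
    ∃ ε > 0, ∀ q : Fin n → ℝ, (∀ j : Fin n, j.1 ≤ c → |q j| < ε * q ⟨c + 1, hn⟩) →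
      ∀ (r : ℕ) (x : Fin r → Fin n → ℝ), (∀ k, x k ∈ cubicCone c n) → ∑ k, x k = q →
        c + 2 ≤ r := by
  obtain ⟨z, K, hz, hK⟩ := exists_interpolation_cubic hc
  have hK1 : 0 < max K 1 := lt_max_of_lt_right one_pos
  refine ⟨((c + 1) * max K 1)⁻¹, by positivity, fun q hq r x hx hsum => ?_⟩
  by_contra! hr
  choose l θ y hxy using fun k => (IsCircleRoot.mem_cubicCone_iff (c := c) hz).1 (hx k)
  obtain ⟨F, ⟨φ, hφ, hF⟩, hzF⟩ := hK fun k => if h : k < r then θ ⟨k, h⟩ else 0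
  have hzθ : ∀ k, z (θ k) = F (θ k) := fun k => by simpa using hzF k.1 (by omega)
  have hsum' : ∀ j, q j = ∑ k, x k j := fun j => by rw [← hsum, Finset.sum_apply]
  have hqz : q ⟨c + 1, hn⟩ = ∑ i : Fin (c + 1), φ i * q ⟨i, by omega⟩ := by
    simp only [hsum', Finset.mul_sum]
    rw [Finset.sum_comm]
    refine Finset.sum_congr rfl fun k _ => ?_
    simp only [hxy k, conePoint, Nat.not_succ_le_self, if_true, if_false, hzθ, hF,
      Fin.is_le, Finset.sum_range, Finset.mul_sum]
    exact Finset.sum_congr rfl fun i _ => by ring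
  have hlt : ∑ i : Fin (c + 1), φ i * q ⟨i, by omega⟩ <
      ∑ i : Fin (c + 1), (c + 1 : ℝ)⁻¹ * q ⟨c + 1, hn⟩ := by
    refine Finset.sum_lt_sum_of_nonempty Finset.univ_nonempty fun i _ => ?_
    calc φ i * q ⟨i, by omega⟩ ≤ |φ i| * |q ⟨i, by omega⟩| :=
          (le_abs_self _).trans (abs_mul _ _).le
      _ ≤ max K 1 * |q ⟨i, by omega⟩| :=
          mul_le_mul_of_nonneg_right ((hφ _).trans (le_max_left _ _)) (abs_nonneg _)
      _ < max K 1 * (((c + 1) * max K 1)⁻¹ * q ⟨c + 1, hn⟩) :=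
          mul_lt_mul_of_pos_left (hq _ i.is_le) hK1
      _ = (c + 1 : ℝ)⁻¹ * q ⟨c + 1, hn⟩ := by field_simp
  rw [← hqz, Finset.sum_const, Finset.card_univ, Fintype.card_fin, nsmul_eq_mul, ← mul_assoc,
    Nat.cast_add, Nat.cast_one, mul_inv_cancel₀ (by positivity), one_mul] at hlt
  exact lt_irrefl _ hlt

lemma add_mem_cubicCone {c n : ℕ} {x w : Fin n → ℝ} (hx : x ∈ cubicCone c n)
    (hw : ∀ j, j.1 ≤ c + 1 → w j = 0) : x + w ∈ cubicCone c n := by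
  obtain ⟨l, s, t, z, y, hz, rfl⟩ := hx
  refine ⟨l, s, t, z, y + w, hz, ?_⟩
  funext j
  simp only [conePoint, Pi.add_apply]
  split_ifs with h1 h2
  · rw [hw j (by omega), add_zero]
  · rw [hw j (by omega), add_zero]
  · rfl

lemma exists_sum_mem_cubicCone {c n : ℕ} (hc : 1 ≤ c) (hn : c + 1 < n) (q : Fin n → ℝ) :
    ∃ x : Fin (c + 2) → Fin n → ℝ, (∀ k, x k ∈ cubicCone c n) ∧ ∑ k, x k = q := by
  set π : (Fin n → ℝ) →ₗ[ℝ] (Fin (c + 2) → ℝ) := LinearMap.funLeft ℝ ℝ (Fin.castLE hn)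
  have hπ : Function.Surjective π :=
    LinearMap.funLeft_surjective_of_injective _ _ _ (Fin.castLE_injective hn)
  have hspan : Submodule.span ℝ (π '' cubicCone c n) = ⊤ := by
    by_contra hne
    obtain ⟨f, hf, hle⟩ := Submodule.exists_le_ker_of_lt_top _ (lt_top_iff_ne_top.2 hne)
    have h0 : (fun i => f (π fun j => if i = j then 1 else 0)) = 0 :=
      eq_zero_of_forall_mem_cubicCone hc hn fun x hx => by
        have h1 : f (π x) = 0 := hle (Submodule.subset_span ⟨x, hx, rfl⟩)
        exact ((Finset.sum_congr rfl fun i _ => mul_comm _ _).trans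
          ((f.comp π).pi_apply_eq_sum_univ x).symm).trans h1
    refine hf (LinearMap.ext fun v => ?_)
    obtain ⟨x, rfl⟩ := hπ v
    have h2 := (f.comp π).pi_apply_eq_sum_univ x
    simp only [LinearMap.comp_apply] at h2
    rw [h2]
    exact Finset.sum_eq_zero fun i _ => by
      rw [show f (π fun j => if i = j then 1 else 0) = 0 from congrFun h0 i, smul_zero]
  have hrank : Module.finrank ℝ (Submodule.span ℝ (π '' cubicCone c n)) = c + 2 := by
    rw [hspan, finrank_top, Module.finrank_fin_fun]
  have hbasis := Submodule.exists_fun_fin_finrank_span_eq ℝ (π '' cubicCone c n)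
  rw [hrank, hspan] at hbasis
  obtain ⟨v, hv, hvspan, -⟩ := hbasis
  choose x hx hxv using hv
  obtain ⟨a, ha⟩ := (Submodule.mem_span_range_iff_exists_fun ℝ).1
    (hvspan ▸ Submodule.mem_top : π q ∈ Submodule.span ℝ (Set.range v))
  set w : Fin n → ℝ := q - ∑ k, a k • x k with hw
  have hw0 : ∀ j : Fin n, j.1 ≤ c + 1 → w j = 0 := fun j hj => by
    have h1 : π w = 0 := by simp only [hw, map_sub, map_sum, map_smul, hxv, ha, sub_self]
    exact congrFun h1 ⟨j, by omega⟩
  refine ⟨fun k => a k • x k + Pi.single (M := fun _ => Fin n → ℝ) 0 w k,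
    fun k => add_mem_cubicCone (smul_mem_cubicCone (hx k) _) fun j hj => ?_, ?_⟩
  · rcases eq_or_ne k 0 with rfl | hk
    · rw [Pi.single_eq_same, hw0 j hj]
    · rw [Pi.single_eq_of_ne hk, Pi.zero_apply]
  · rw [Finset.sum_add_distrib, Fintype.sum_pi_single', hw]
    abel

lemma exists_isOpen_realRank_cubicCone {c n : ℕ} (hc : 1 ≤ c) (hn : c + 1 < n) :
    ∃ p : Fin n → ℝ, p ≠ 0 ∧ ∃ U : Set (Fin n → ℝ), IsOpen U ∧ p ∈ U ∧
      ∀ q ∈ U, realRank (cubicCone c n) q = (c + 2 : ℕ) := by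
  obtain ⟨ε, hε, hle⟩ := exists_forall_le_of_sum_mem_cubicCone hc hn
  refine ⟨Pi.single ⟨c + 1, hn⟩ 1, by simp,
    {q | ∀ j : Fin n, j.1 ≤ c → |q j| < ε * q ⟨c + 1, hn⟩}, ?_, fun j hj => ?_, fun q hq => ?_⟩
  · simp only [Set.ofPred_forall]
    exact isOpen_iInter_of_finite fun j => isOpen_iInter_of_finite fun _ =>
      isOpen_lt (by fun_prop) (by fun_prop)
  · rw [Pi.single_eq_same, Pi.single_eq_of_ne (fun h => by simp [h] at hj)]
    simpa using hε
  · refine le_antisymm (sInf_le ⟨c + 2, exists_sum_mem_cubicCone hc hn q, rfl⟩) (le_sInf ?_)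
    rintro _ ⟨r, ⟨x, hx, hsum⟩, rfl⟩
    exact Nat.cast_le.2 (hle q hq r x hx hsum)

lemma hasDerivAt_eval_comp {σ : Type*} [Fintype σ] {γ : ℝ → σ → ℝ} {γ' : σ → ℝ} {τ : ℝ}
    (hγ : ∀ i, HasDerivAt (γ · i) (γ' i) τ) (f : MvPolynomial σ ℝ) :
    HasDerivAt (fun u => eval (γ u) f) (∑ i, γ' i * eval (γ τ) (pderiv i f)) τ := by
  classical
  induction f using MvPolynomial.induction_on with
  | C a => simpa using hasDerivAt_const τ a
  | add p q hp hq =>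
    simp only [map_add, mul_add, Finset.sum_add_distrib]
    exact hp.add hq
  | mul_X p j hp =>
    simp only [map_mul, eval_X]
    refine (hp.mul (hγ j)).congr_deriv ?_
    rw [Finset.sum_mul, ← Finset.sum_erase_add _ _ (Finset.mem_univ j),
      ← Finset.sum_erase_add _ _ (Finset.mem_univ j), add_assoc]
    congr 1
    · refine Finset.sum_congr rfl fun i hi => ?_
      rw [pderiv_mul, pderiv_X_of_ne (Finset.ne_of_mem_erase hi).symm, mul_zero, add_zero,
        map_mul, eval_X]
      ring
    · rw [pderiv_mul, pderiv_X_self, mul_one, map_add, map_mul, eval_X]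
      ring

/-- Gradients of polynomials vanishing on `S` are orthogonal to velocity vectors of curves in
`S`. -/
lemma sum_mul_eval_pderiv_eq_zero {σ : Type*} [Fintype σ] {S : Set (σ → ℝ)} {γ : ℝ → σ → ℝ}
    {γ' : σ → ℝ} {τ : ℝ} (hS : ∀ u, γ u ∈ S) (hγ : ∀ i, HasDerivAt (γ · i) (γ' i) τ)
    {f : MvPolynomial σ ℝ} (hf : f ∈ vanishingIdeal ℝ S) :
    ∑ i, γ' i * eval (γ τ) (pderiv i f) = 0 := by
  have h := hasDerivAt_eval_comp hγ f
  rw [show (fun u => eval (γ u) f) = fun _ => 0 from funext fun u => by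
    rw [← coe_aeval_eq_eval, RingHom.coe_coe, hf _ (hS u)]] at h
  exact h.unique (hasDerivAt_const τ 0)

lemma eval_pderiv_X {σ : Type*} [DecidableEq σ] (p : σ → ℝ) (i j : σ) :
    eval p (pderiv j (X i : MvPolynomial σ ℝ)) = (Pi.single i 1 : σ → ℝ) j := by
  rcases eq_or_ne i j with rfl | h
  · rw [pderiv_X_self, map_one, Pi.single_eq_same]
  · rw [pderiv_X_of_ne h, map_zero, Pi.single_eq_of_ne h.symm]

section SmoothPoint

variable {c n : ℕ}

lemma IsCircleRoot.apply_pi_div_two {z : ℝ → ℝ} (hc : 1 ≤ c) (hz : IsCircleRoot c z) :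
    z (Real.pi / 2) = 0 := by
  refine cubic_injective zero_le_one ?_
  simpa [show c ≠ 0 by omega] using hz (Real.pi / 2)

lemma single_eq_conePoint {z : ℝ → ℝ} (hc : 1 ≤ c) (hn : c + 1 < n) (hz : IsCircleRoot c z) :
    (Pi.single ⟨c, by omega⟩ 1 : Fin n → ℝ) = conePoint c 1 (Real.cos (Real.pi / 2))
      (Real.sin (Real.pi / 2)) (1 * z (Real.pi / 2)) 0 := by
  funext j
  simp only [conePoint, Pi.single_apply, Fin.ext_iff, Real.cos_pi_div_two, Real.sin_pi_div_two,
    hz.apply_pi_div_two hc, one_pow, mul_one, one_mul, Pi.zero_apply]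
  split_ifs with h1 h2 h2 <;> first | omega | rfl | skip
  · simp [h1]
  · rw [zero_pow (by omega)]

lemma single_mem_cubicCone (hc : 1 ≤ c) (hn : c + 1 < n) :
    (Pi.single ⟨c, by omega⟩ 1 : Fin n → ℝ) ∈ cubicCone c n := by
  obtain ⟨z, hz⟩ := exists_isCircleRoot c
  rw [single_eq_conePoint hc hn hz]
  exact hz.mem_cubicCone _ _ _

/-- The gradients at the smooth point `e_c` lie in a space of dimension `c`. -/
lemma exists_gradient_relations (hc : 1 ≤ c) (hn : c + 1 < n) :
    ∃ ζ : ℝ, ∀ f ∈ vanishingIdeal ℝ (cubicCone c n), ∀ g : Fin n → ℝ,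
      (g = fun i => eval (Pi.single ⟨c, by omega⟩ 1) (pderiv i f)) →
      g ⟨c, by omega⟩ = 0 ∧ (∀ j, c + 1 < j.1 → g j = 0) ∧
        g ⟨c - 1, by omega⟩ = ζ * g ⟨c + 1, hn⟩ := by
  obtain ⟨z, hz⟩ := exists_isCircleRoot c
  refine ⟨deriv z (Real.pi / 2), ?_⟩
  rintro f hf g rfl
  have hmem := single_mem_cubicCone hc hn
  set p : Fin n → ℝ := Pi.single ⟨c, by omega⟩ 1 with hp
  have hline : ∀ (w : Fin n → ℝ) i, HasDerivAt (fun u : ℝ => (p + u • w) i) (w i) 0 :=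
    fun w i => by
      simpa using ((hasDerivAt_id (0 : ℝ)).mul_const (w i)).const_add (p i)
  have hc0 : eval p (pderiv ⟨c, by omega⟩ f) = 0 := by
    have h := sum_mul_eval_pderiv_eq_zero (S := cubicCone c n) (γ := fun u => p + u • p)
      (fun u => by
        rw [show p + u • p = (1 + u) • p by rw [add_smul, one_smul]]
        exact smul_mem_cubicCone hmem _) (hline p) hf
    simpa [hp, Pi.single_apply] using h
  have hy0 : ∀ j : Fin n, c + 1 < j.1 → eval p (pderiv j f) = 0 := fun j hj => by
    have h := sum_mul_eval_pderiv_eq_zero (S := cubicCone c n)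
      (γ := fun u => p + u • Pi.single j 1) (fun u => by
        refine add_mem_cubicCone hmem fun i hi => ?_
        rw [Pi.smul_apply, Pi.single_eq_of_ne (fun h => by omega), smul_zero])
      (hline _) hf
    simpa [Pi.single_apply] using h
  refine ⟨hc0, hy0, ?_⟩
  have h := sum_mul_eval_pderiv_eq_zero (S := cubicCone c n) (τ := Real.pi / 2)
    (γ := fun θ => conePoint c 1 (Real.cos θ) (Real.sin θ) (1 * z θ) 0)
    (γ' := fun j => if j.1 ≤ c then -((c - j.1 : ℕ) * 0 ^ (c - j.1 - 1)) else
      if j.1 = c + 1 then deriv z (Real.pi / 2) else 0)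
    (fun θ => hz.mem_cubicCone 1 θ 0) (fun j => by
      simp only [conePoint, one_mul]
      split_ifs
      · refine (((Real.hasDerivAt_cos (Real.pi / 2)).fun_pow (c - j.1)).mul
          ((Real.hasDerivAt_sin (Real.pi / 2)).fun_pow j.1)).congr_deriv ?_
        simp
      · exact (hz.analyticAt _).differentiableAt.hasDerivAt
      · exact hasDerivAt_const _ _) hf
  rw [← single_eq_conePoint hc hn hz,
    ← Finset.add_sum_erase _ _ (Finset.mem_univ ⟨c - 1, by omega⟩),
    ← Finset.add_sum_erase _ _ (Finset.mem_erase.2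
      ⟨show (⟨c + 1, hn⟩ : Fin n) ≠ ⟨c - 1, by omega⟩ from fun h => by
        have : c + 1 = c - 1 := congrArg Fin.val h
        omega, Finset.mem_univ _⟩), Finset.sum_eq_zero] at h
  · simp only [show c - 1 ≤ c by omega, show c - (c - 1) = 1 by omega, if_true,
      Nat.not_succ_le_self, if_false] at h
    push_cast at h
    simp only [pow_zero, mul_one, add_zero] at h
    linear_combination -h
  · intro j hj
    simp only [Finset.mem_erase, ne_eq, Fin.ext_iff, Finset.mem_univ, and_true] at hj
    split_ifs with h1
    · rcases h1.lt_or_eq with h2 | h2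
      · rw [zero_pow (by omega)]
        simp
      · rw [h2]
        simp
    · exact absurd ‹_› hj.1
    · rw [zero_mul]

lemma finrank_span_gradient (hc : 1 ≤ c) (hn : c + 1 < n) :
    Module.finrank ℝ (Submodule.span ℝ {g : Fin n → ℝ |
      ∃ f ∈ vanishingIdeal ℝ (cubicCone c n),
        g = fun i => eval (Pi.single ⟨c, by omega⟩ 1) (pderiv i f)}) = c := by
  obtain ⟨ζ, hζ⟩ := exists_gradient_relations hc hn
  set p : Fin n → ℝ := Pi.single ⟨c, by omega⟩ 1 with hp
  set W := Submodule.span ℝ {g : Fin n → ℝ |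
      ∃ f ∈ vanishingIdeal ℝ (cubicCone c n), g = fun i => eval p (pderiv i f)}
  let L : (Fin n → ℝ) →ₗ[ℝ] (Fin c → ℝ) := LinearMap.funLeft ℝ ℝ
    fun i => if i.1 + 1 = c then ⟨c + 1, hn⟩ else ⟨i.1, by omega⟩
  have hL : ∀ g i, L g i = g (if i.1 + 1 = c then ⟨c + 1, hn⟩ else ⟨i.1, by omega⟩) :=
    fun _ _ => rfl
  have hW : ∀ g ∈ W, g ⟨c, by omega⟩ = 0 ∧ (∀ j, c + 1 < j.1 → g j = 0) ∧
      g ⟨c - 1, by omega⟩ = ζ * g ⟨c + 1, hn⟩ := fun g hg => by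
    induction hg using Submodule.span_induction with
    | mem g hg =>
      obtain ⟨f, hf, hg⟩ := hg
      exact hζ f hf g hg
    | zero => simp
    | add g h _ _ hg hh =>
      refine ⟨by simp [hg.1, hh.1], fun j hj => by simp [hg.2.1 j hj, hh.2.1 j hj], ?_⟩
      simp only [Pi.add_apply, hg.2.2, hh.2.2]
      ring
    | smul a g _ hg =>
      refine ⟨by simp [hg.1], fun j hj => by simp [hg.2.1 j hj], ?_⟩
      simp only [Pi.smul_apply, hg.2.2, smul_eq_mul]
      ring
  have hinj : Function.Injective (L.domRestrict W) := by
    refine (injective_iff_map_eq_zero _).2 fun ⟨g, hg⟩ h0 => Subtype.ext (funext fun j => ?_)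
    obtain ⟨h1, h2, h3⟩ := hW g hg
    have h4 : ∀ i, L g i = 0 := fun i => congrFun h0 i
    have hz : g ⟨c + 1, hn⟩ = 0 := by
      have h5 := h4 ⟨c - 1, by omega⟩
      rwa [hL, if_pos (by simp only; omega)] at h5
    rw [hz, mul_zero] at h3
    change g j = 0
    rcases lt_or_ge (c + 1) j.1 with hj | hj
    · exact h2 j hj
    by_cases hj1 : j.1 = c + 1
    · rwa [show j = ⟨c + 1, hn⟩ from Fin.ext hj1]
    by_cases hj2 : j.1 = c
    · rwa [show j = ⟨c, by omega⟩ from Fin.ext hj2]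
    by_cases hj3 : j.1 = c - 1
    · rwa [show j = ⟨c - 1, by omega⟩ from Fin.ext hj3]
    have h5 := h4 ⟨j.1, by omega⟩
    rwa [hL, if_neg (by simp only; omega)] at h5
  have hgrad : ∀ i : Fin n, i.1 + 1 < c → (Pi.single i 1 : Fin n → ℝ) ∈ W := fun i hi => by
    refine Submodule.subset_span ⟨_, X_mul_X_sub_mem_vanishingIdeal (i := i)
      (j := ⟨c, by omega⟩) (k := ⟨c - 1, by omega⟩) (l := ⟨i + 1, by omega⟩) (by omega) le_rfl
      (by simp) (by simp only; omega) (by simp only; omega), funext fun j => ?_⟩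
    have h1 : p i = 0 := Pi.single_eq_of_ne (fun h => by simp [h] at hi) _
    have h2 : p ⟨c, by omega⟩ = 1 := Pi.single_eq_same _ _
    have h3 : p ⟨c - 1, by omega⟩ = 0 := Pi.single_eq_of_ne (by simp; omega) _
    have h4 : p ⟨i + 1, by omega⟩ = 0 := Pi.single_eq_of_ne (by simp; omega) _
    simp only [pderiv_mul, map_sub, map_add, map_mul, eval_X, h1, h2, h3, h4, mul_zero, mul_one,
      zero_mul, add_zero, sub_zero, eval_pderiv_X]
  have hgrad' : ∃ f ∈ vanishingIdeal ℝ (cubicCone c n), (fun j => eval p (pderiv j f)) =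
      Pi.single ⟨c + 1, hn⟩ 1 - Pi.single ⟨0, by omega⟩ 1 := by
    refine ⟨_, cubic_mem_vanishingIdeal (i := ⟨0, by omega⟩) (j := ⟨c, by omega⟩)
      (k := ⟨c + 1, hn⟩) rfl rfl rfl, funext fun j => ?_⟩
    have h1 : p ⟨0, by omega⟩ = 0 := Pi.single_eq_of_ne (by simp; omega) _
    have h2 : p ⟨c, by omega⟩ = 1 := Pi.single_eq_same _ _
    have h3 : p ⟨c + 1, hn⟩ = 0 := Pi.single_eq_of_ne (by simp) _
    simp only [pderiv_mul, pderiv_pow, map_sub, map_add, map_mul, map_pow, map_natCast, eval_X,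
      h1, h2, h3, eval_pderiv_X, Pi.sub_apply]
    ring
  have hsurj : ∀ i : Fin c, ∃ w : W, L.domRestrict W w = Pi.single i 1 := fun i => by
    by_cases hi : i.1 + 1 = c
    · obtain ⟨f, hf, hfg⟩ := hgrad'
      have hw : (Pi.single ⟨c + 1, hn⟩ 1 - Pi.single ⟨0, by omega⟩ 1 : Fin n → ℝ) ∈ W :=
        Submodule.subset_span ⟨f, hf, hfg.symm⟩
      rcases hc.eq_or_lt with rfl | hc1
      · refine ⟨⟨_, hw⟩, funext fun j => ?_⟩
        rw [LinearMap.domRestrict_apply, hL, Subsingleton.elim j i, if_pos hi]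
        simp
      · refine ⟨⟨_, W.add_mem hw (hgrad ⟨0, by omega⟩ (by simp only; omega))⟩,
          funext fun j => ?_⟩
        rw [LinearMap.domRestrict_apply, hL]
        rcases eq_or_ne j i with rfl | hji
        · simp [hi]
        · have hj : j.1 ≠ i.1 := fun h => hji (Fin.ext h)
          simp [hji, Fin.ext_iff, show ¬j.1 + 1 = c by omega, show j.1 ≠ c + 1 by omega]
    · refine ⟨⟨_, hgrad ⟨i, by omega⟩ (by simp only; omega)⟩, funext fun j => ?_⟩
      rw [LinearMap.domRestrict_apply, hL]
      simp only [Pi.single_apply, Fin.ext_iff]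
      split_ifs <;> first | rfl | (simp only at *; omega)
  have hsurj' : Function.Surjective (L.domRestrict W) := by
    refine LinearMap.range_eq_top.1 (top_le_iff.1 ?_)
    rw [← (Pi.basisFun ℝ (Fin c)).span_eq, Submodule.span_le]
    rintro _ ⟨i, rfl⟩
    obtain ⟨w, hw⟩ := hsurj i
    exact ⟨w, by rw [hw, Pi.basisFun_apply]⟩
  rw [(LinearEquiv.ofBijective _ ⟨hinj, hsurj'⟩).finrank_eq, Module.finrank_fin_fun]

end SmoothPoint

/-- An injective integral extension preserves the Krull dimension. -/
lemma ringKrullDim_eq_of_isIntegral_of_injective {R S : Type*} [CommRing R] [CommRing S]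
    {φ : R →+* S} (hφi : φ.IsIntegral) (hφ : Function.Injective φ) :
    ringKrullDim S = ringKrullDim R := by
  algebraize [φ]
  have : FaithfulSMul R S := (faithfulSMul_iff_algebraMap_injective R S).2 hφ
  refine le_antisymm (Order.krullDim_le_of_strictMono (PrimeSpectrum.comap (algebraMap R S))
    fun P Q hPQ => Ideal.IsIntegral.comap_lt_comap hPQ) (iSup_le fun l => ?_)
  obtain ⟨P, _, hP, hPl⟩ := Ideal.exists_ideal_over_prime_of_isIntegral (S := S)
    (RelSeries.head l).asIdeal ⊥ (by
      rw [Ideal.comap_bot_of_injective (algebraMap R S) hφ]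
      exact bot_le)
  have : P.LiesOver (RelSeries.head l).asIdeal := ⟨hPl.symm⟩
  obtain ⟨L, hL, -⟩ := Ideal.exists_ltSeries_of_hasGoingUp l P
  rw [← hL]
  exact Order.LTSeries.length_le_krullDim L

/-- The `c`-th power of a coordinate of the rational normal curve is a monomial in the first and
the last coordinate. -/
lemma X_pow_sub_mem_vanishingIdeal {c n : ℕ} {i j k : Fin n} (hi : i.1 ≤ c) (hj : j.1 = 0)
    (hk : k.1 = c) :
    (X i ^ c - X j ^ (c - i.1) * X k ^ i.1 : MvPolynomial (Fin n) ℝ) ∈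
      vanishingIdeal ℝ (cubicCone c n) := by
  rintro x ⟨m, s, t, z, y, -, rfl⟩
  simp only [map_sub, map_mul, map_pow, aeval_X, conePoint, hi, hj, hk, le_refl, if_true,
    Nat.zero_le, Nat.sub_self, Nat.sub_zero, pow_zero, mul_one, one_mul, mul_pow, ← pow_mul]
  rw [show m ^ c = m ^ (c - i.1) * m ^ i.1 by rw [← pow_add]; congr 1; omega]
  ring

section KrullDim

variable {c d : ℕ}

/-- The inclusion of the coordinates `x₀, x_c, x_{c+2}, …, x_{c+d}` into all the coordinates. -/
def noetherIndex (c d : ℕ) (i : Fin (d + 1)) : Fin (d + c + 1) :=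
  if i.1 = 0 then ⟨0, by omega⟩ else if i.1 = 1 then ⟨c, by omega⟩ else ⟨c + i.1, by omega⟩

lemma exists_mem_cubicCone_noetherIndex (hc : 1 ≤ c) (hd : 1 ≤ d) {w : Fin (d + 1) → ℝ}
    (hw : ∀ i, 0 < w i) :
    ∃ x ∈ cubicCone c (d + c + 1), x ∘ noetherIndex c d = w := by
  set u := w ⟨0, by omega⟩
  set v := w ⟨1, by omega⟩
  have hu : 0 < u := hw _
  have hv : 0 < v := hw _
  obtain ⟨z, hz⟩ := exists_cubic_eq (add_nonneg (sq_nonneg u) (sq_nonneg v))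
    (u * (u ^ 2 + v ^ 2))
  have ht : u * ((v / u) ^ (c : ℝ)⁻¹) ^ c = v := by
    rw [Real.rpow_inv_natCast_pow (by positivity) (by omega)]
    field_simp
  refine ⟨conePoint c u 1 ((v / u) ^ (c : ℝ)⁻¹) z fun j => if h : j.1 - c < d + 1 then
    w ⟨j.1 - c, h⟩ else 0, ⟨_, _, _, _, _, by rw [ht, one_pow, mul_one, hz], rfl⟩,
    funext fun i => ?_⟩
  simp only [Function.comp_apply, noetherIndex]
  split_ifs with h0 h1
  · simp [conePoint, u, show i = ⟨0, by omega⟩ from Fin.ext h0]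
  · simpa [conePoint, show i = ⟨1, by omega⟩ from Fin.ext h1] using ht
  · simp only [conePoint]
    rw [if_neg (by omega), if_neg (by omega), dif_pos (by omega)]
    simp

lemma ringKrullDim_quotient_vanishingIdeal_cubicCone (hc : 1 ≤ c) (hd : 1 ≤ d) :
    ringKrullDim (MvPolynomial (Fin (d + c + 1)) ℝ ⧸ vanishingIdeal ℝ (cubicCone c (d + c + 1))) =
      (d + 1 : ℕ) := by
  set I := vanishingIdeal ℝ (cubicCone c (d + c + 1))
  have hn : c + 1 < d + c + 1 := by omega
  let φ : MvPolynomial (Fin (d + 1)) ℝ →+* MvPolynomial (Fin (d + c + 1)) ℝ ⧸ I :=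
    (Ideal.Quotient.mk I).comp (rename (noetherIndex c d)).toRingHom
  have hφX : ∀ i, φ (X i) = Ideal.Quotient.mk I (X (noetherIndex c d i)) := fun i =>
    congrArg (Ideal.Quotient.mk I) (rename_X _ _)
  have hφ : Function.Injective φ := by
    refine (injective_iff_map_eq_zero _).2 fun f hf => ?_
    refine funext_set (fun _ => Set.Ioi (0 : ℝ)) (fun _ => Set.Ioi_infinite _) fun w hw => ?_
    obtain ⟨x, hx, hxw⟩ := exists_mem_cubicCone_noetherIndex hc hd fun i => hw i trivial
    have h := Ideal.Quotient.eq_zero_iff_mem.1 hf x hx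
    rw [map_zero, ← hxw, ← h]
    exact (aeval_rename _ _ _).symm
  have hφi : φ.IsIntegral := by
    let := φ.toAlgebra
    have hidx : ∀ i, IsIntegral (MvPolynomial (Fin (d + 1)) ℝ)
        (Ideal.Quotient.mk I (X (noetherIndex c d i))) := fun i => by
      rw [← hφX]
      exact isIntegral_algebraMap
    have h0 : noetherIndex c d ⟨0, by omega⟩ = ⟨0, by omega⟩ := rfl
    have h1 : noetherIndex c d ⟨1, by omega⟩ = ⟨c, by omega⟩ := rfl
    have hX : ∀ i, IsIntegral (MvPolynomial (Fin (d + 1)) ℝ) (Ideal.Quotient.mk I (X i)) := by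
      intro i
      rcases lt_trichotomy i.1 (c + 1) with hi | hi | hi
      · refine IsIntegral.of_pow (n := c) (by omega) ?_
        rw [← map_pow, Ideal.Quotient.eq.2 (X_pow_sub_mem_vanishingIdeal (c := c) (i := i)
          (j := ⟨0, by omega⟩) (k := ⟨c, by omega⟩) (by omega) rfl rfl), map_mul, map_pow, map_pow]
        exact ((h0 ▸ hidx _).pow _).mul ((h1 ▸ hidx _).pow _)
      · set q : MvPolynomial (Fin (d + 1)) ℝ := X ⟨0, by omega⟩ ^ 2 + X ⟨1, by omega⟩ ^ 2 with hq
        refine ⟨.X ^ 3 + (.X * .C q - .C (X ⟨0, by omega⟩ * q)), ?_, ?_⟩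
        · monicity!
        · have h := Ideal.Quotient.eq_zero_iff_mem.2 (cubic_mem_vanishingIdeal (c := c)
            (i := ⟨0, by omega⟩) (j := ⟨c, by omega⟩) (k := i) rfl rfl hi)
          simp only [Polynomial.eval₂_add, Polynomial.eval₂_sub, Polynomial.eval₂_mul,
            Polynomial.eval₂_pow, Polynomial.eval₂_X, Polynomial.eval₂_C]
          change _ + (_ * φ q - φ _) = 0
          rw [hq]
          simp only [map_add, map_mul, map_pow, hφX, h0, h1]
          simp only [map_add, map_sub, map_mul, map_pow] at h
          linear_combination h
      · convert hidx ⟨i.1 - c, by omega⟩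
        simp only [noetherIndex, Fin.ext_iff]
        rw [if_neg (by omega), if_neg (by omega)]
        simp only
        omega
    intro x
    obtain ⟨p, rfl⟩ := Ideal.Quotient.mk_surjective x
    change IsIntegral (MvPolynomial (Fin (d + 1)) ℝ) _
    induction p using MvPolynomial.induction_on with
    | C a =>
      rw [← rename_C (noetherIndex c d) a]
      exact isIntegral_algebraMap
    | add p q hp hq => exact (map_add (Ideal.Quotient.mk I) p q) ▸ hp.add hq
    | mul_X p j hp => exact (map_mul (Ideal.Quotient.mk I) p _) ▸ hp.mul (hX j)
  rw [ringKrullDim_eq_of_isIntegral_of_injective hφi hφ, ringKrullDim_of_isNoetherianRing]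
  simp

end KrullDim

lemma eval_eq_zero_of_mem_vanishingIdeal {σ : Type*} {S : Set (σ → ℝ)} {f : MvPolynomial σ ℝ}
    (hf : f ∈ vanishingIdeal ℝ S) {x : σ → ℝ} (hx : x ∈ S) : eval x f = 0 := by
  rw [← coe_aeval_eq_eval, RingHom.coe_coe]
  exact hf x hx

lemma realVariety_vanishingIdeal_cubicCone {c n : ℕ} (hc : 1 ≤ c) (hn : c + 1 < n + 1) :
    realVariety (vanishingIdeal ℝ (cubicCone c (n + 1))) = cubicCone c (n + 1) := by
  refine Set.Subset.antisymm (fun x hx => mem_cubicCone_of_forall_vanishingIdeal hc hn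
    fun f hf => ?_) fun x hx f hf => eval_eq_zero_of_mem_vanishingIdeal hf hx
  rw [← RingHom.coe_coe, coe_aeval_eq_eval]
  exact hx f hf

lemma eq_zero_of_mem_vanishingIdeal_cubicCone_of_mem_homogeneousSubmodule {c n : ℕ} (hc : 1 ≤ c)
    (hn : c + 1 < n) {f : MvPolynomial (Fin n) ℝ} (hf : f ∈ vanishingIdeal ℝ (cubicCone c n))
    (hf1 : f ∈ homogeneousSubmodule (Fin n) ℝ 1) : f = 0 := by
  rw [homogeneousSubmodule_one_eq_span_X, Submodule.mem_span_range_iff_exists_fun] at hf1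
  obtain ⟨a, rfl⟩ := hf1
  rw [eq_zero_of_forall_mem_cubicCone hc hn (a := a) fun x hx => ?_]
  · simp
  · simpa [smul_eq_C_mul] using hf x hx

/-- For all `d, c ≥ 1` there is a homogeneous prime ideal `I ⊆ ℝ[x₀,…,x_{d+c}]` containing no
nonzero linear form, defining an irreducible nondegenerate variety of dimension `d` (Krull
dimension of the quotient is `d + 1`) with a smooth real point, and a nonzero point `p` with a
Euclidean open neighborhood `U` on which every point has real rank exactly `c + 2` with respect
to `V_ℝ(I)`. -/
theorem statement6 (d c : ℕ) (hd : 1 ≤ d) (hc : 1 ≤ c) :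
    ∃ I : Ideal (MvPolynomial (Fin (d + c + 1)) ℝ),
      (∀ f ∈ I, ∀ e : ℕ, (homogeneousComponent e f) ∈ I) ∧
      I.IsPrime ∧
      (∀ f ∈ I, f ∈ homogeneousSubmodule (Fin (d + c + 1)) ℝ 1 → f = 0) ∧
      ringKrullDim (MvPolynomial (Fin (d + c + 1)) ℝ ⧸ I) = (d + 1 : ℕ) ∧
      (∃ x : Fin (d + c + 1) → ℝ, x ≠ 0 ∧ x ∈ realVariety I ∧
        Module.finrank ℝ (Submodule.span ℝ
          {g : Fin (d + c + 1) → ℝ | ∃ f ∈ I, g = fun i => eval x (pderiv i f)}) = c) ∧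
      ∃ p : Fin (d + c + 1) → ℝ, p ≠ 0 ∧
        ∃ U : Set (Fin (d + c + 1) → ℝ), IsOpen U ∧ p ∈ U ∧
          ∀ q ∈ U, realRank (realVariety I) q = (c + 2 : ℕ) := by
  have hn : c + 1 < d + c + 1 := by omega
  refine ⟨vanishingIdeal ℝ (cubicCone c (d + c + 1)),
    fun f hf e => homogeneousComponent_mem_vanishingIdeal (fun x hx => smul_mem_cubicCone hx) hf e,
    isPrime_vanishingIdeal_cubicCone c _, fun f =>
      eq_zero_of_mem_vanishingIdeal_cubicCone_of_mem_homogeneousSubmodule hc hn,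
    ringKrullDim_quotient_vanishingIdeal_cubicCone hc hd, ?_⟩
  rw [realVariety_vanishingIdeal_cubicCone hc hn]
  exact ⟨⟨Pi.single ⟨c, by omega⟩ 1, by simp, single_mem_cubicCone hc hn,
    finrank_span_gradient hc hn⟩, exists_isOpen_realRank_cubicCone hc hn⟩
end
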